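/- (Lemma 11, weighted smoothing estimate for the Fourier multiplier e^{iσV(D)}) Let β > 1 and let V ∈ C^∞(ℝ^d;ℝ) satisfy V(ξ) = |ξ|^β·V(ξ/|ξ|) for all |ξ| ≥ 1 and ∇V(ω) ≠ 0 for every ω in the unit sphere S^{d−1}. Let σ ≠ 0 and N ∈ ℤ₊, and set s = (β−1)N. Then there exists C_N > 0 such that for every u ∈ L²(ℝ^d) with ⟨x⟩^N u ∈ L²(ℝ^d), the function w := F^{−1}( e^{iσV(ξ)} (Fu)(ξ) ) (where F denotes the Fourier–Plancherel transform on L²(ℝ^d)) satisfies: the function ξ ↦ ⟨ξ⟩^s · ( F( ⟨·⟩^{−N} w ) )(ξ) belongs to L²(ℝ^d), with ‖ ⟨·⟩^s F( ⟨·⟩^{−N} w ) ‖_{L²} ≤ C_N ‖ ⟨·⟩^N u ‖_{L²}. (Equivalently, ⟨x⟩^{−N} e^{iσV(D_x)} u belongs to the Sobolev space H^{(β−1)N}(ℝ^d) with the stated bound.) -/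

import Mathlib

open MeasureTheory Filter
open scoped FourierTransform SchwartzMap Topology

noncomputable section

abbrev E (d : ℕ) := EuclideanSpace ℝ (Fin d)

/-- Japanese bracket `⟨x⟩ = (1+|x|²)^{1/2}`. -/
def jap {d : ℕ} (x : E d) : ℝ := Real.sqrt (1 + ‖x‖ ^ 2)

/-- `g` is the Fourier–Plancherel transform of `f`: both are square integrable and they
pair correctly against Schwartz functions (which characterizes the unitary extension of
the Fourier transform to `L²`). -/
def IsFourierL2 {d : ℕ} (f g : E d → ℂ) : Prop :=
  MemLp f 2 (volume : Measure (E d)) ∧ MemLp g 2 (volume : Measure (E d)) ∧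
  ∀ φ : 𝓢(E d, ℂ), ∫ x, f x * 𝓕 (⇑φ) x = ∫ ξ, g ξ * φ ξ

section

open scoped ContDiff LineDeriv ENNReal NNReal

variable {d : ℕ} {F : Type*} [NormedAddCommGroup F] [NormedSpace ℝ F]

lemma one_le_jap (x : E d) : 1 ≤ jap x := by
  rw [jap, Real.one_le_sqrt]; nlinarith [sq_nonneg ‖x‖]

lemma jap_pos (x : E d) : 0 < jap x := one_pos.trans_le (one_le_jap x)

lemma norm_le_jap (x : E d) : ‖x‖ ≤ jap x :=
  Real.le_sqrt_of_sq_le (by linarith)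

lemma jap_le_one_add_norm (x : E d) : jap x ≤ 1 + ‖x‖ := by
  rw [jap, Real.sqrt_le_left (by positivity)]
  nlinarith [norm_nonneg x]

lemma jap_rpow_eq (r : ℝ) (x : E d) : jap x ^ r = (1 + ‖x‖ ^ 2) ^ (r / 2) := by
  rw [jap, Real.sqrt_eq_rpow, ← Real.rpow_mul (by positivity)]
  congr 1; ring

lemma jap_rpow_pos (r : ℝ) (x : E d) : 0 < jap x ^ r := Real.rpow_pos_of_pos (jap_pos x) r

lemma jap_rpow_mono {r s : ℝ} (h : r ≤ s) (x : E d) : jap x ^ r ≤ jap x ^ s :=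
  Real.rpow_le_rpow_of_exponent_le (one_le_jap x) h

lemma jap_rpow_add (r s : ℝ) (x : E d) : jap x ^ (r + s) = jap x ^ r * jap x ^ s :=
  Real.rpow_add (jap_pos x) r s

lemma hasTemperateGrowth_jap_rpow (r : ℝ) :
    (fun x : E d => jap x ^ r).HasTemperateGrowth := by
  simp_rw [jap_rpow_eq]
  exact Function.hasTemperateGrowth_one_add_norm_sq_rpow (E d) (r / 2)

lemma continuous_jap : Continuous (jap : E d → ℝ) := by
  unfold jap; fun_prop

lemma continuous_jap_rpow (r : ℝ) : Continuous (fun x : E d => jap x ^ r) :=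
  (hasTemperateGrowth_jap_rpow r).1.continuous

/-- `b` is a smooth symbol of order `r` (of type `(0,0)`): each derivative is `O(⟨x⟩^r)`. -/
structure IsSymbol (r : ℝ) (b : E d → F) : Prop where
  contDiff : ContDiff ℝ ∞ b
  bound : ∀ n : ℕ, ∃ C, ∀ x, ‖iteratedFDeriv ℝ n b x‖ ≤ C * jap x ^ r

namespace IsSymbol

variable {r s : ℝ} {b c : E d → ℂ}

lemma norm_le {b : E d → F} (hb : IsSymbol r b) : ∃ C : ℝ≥0, ∀ x, ‖b x‖ ≤ C * jap x ^ r := by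
  obtain ⟨C, hC⟩ := hb.bound 0
  refine ⟨C.toNNReal, fun x => ?_⟩
  have := hC x
  rw [norm_iteratedFDeriv_zero] at this
  refine this.trans ?_
  gcongr
  · exact (jap_rpow_pos r x).le
  · exact Real.le_coe_toNNReal C

lemma mono {b : E d → F} (hb : IsSymbol r b) (h : r ≤ s) : IsSymbol s b := by
  refine ⟨hb.contDiff, fun n => ?_⟩
  obtain ⟨C, hC⟩ := hb.bound n
  refine ⟨|C|, fun x => (hC x).trans ?_⟩
  have h1 := jap_rpow_mono h x
  have h2 := jap_rpow_pos r x
  calc C * jap x ^ r ≤ |C| * jap x ^ r := by gcongr; exact le_abs_self C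
    _ ≤ _ := by gcongr

lemma hasTemperateGrowth {b : E d → F} (hb : IsSymbol r b) : b.HasTemperateGrowth := by
  refine ⟨hb.contDiff, fun n => ?_⟩
  obtain ⟨k, hk⟩ := exists_nat_ge r
  obtain ⟨C, hC⟩ := (hb.mono hk).bound n
  refine ⟨k, |C|, fun x => (hC x).trans ?_⟩
  rw [Real.rpow_natCast]
  have := jap_le_one_add_norm x
  have := jap_pos x
  calc C * jap x ^ k ≤ |C| * jap x ^ k := by gcongr; exact le_abs_self C
    _ ≤ _ := by gcongr

end IsSymbol

lemma norm_iteratedFDeriv_smul_bound {r s : ℝ} {b : E d → ℝ} {c : E d → F}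
    (hb : ContDiff ℝ ∞ b) (hc : ContDiff ℝ ∞ c) (n : ℕ)
    (hb' : ∀ i ≤ n, ∃ C, ∀ x, ‖iteratedFDeriv ℝ i b x‖ ≤ C * jap x ^ r)
    (hc' : ∀ i ≤ n, ∃ C, ∀ x, ‖iteratedFDeriv ℝ i c x‖ ≤ C * jap x ^ s) :
    ∃ C, ∀ x, ‖iteratedFDeriv ℝ n (fun x => b x • c x) x‖ ≤ C * jap x ^ (r + s) := by
  choose! B hB using hb'
  choose! D hD using hc'
  refine ⟨∑ i ∈ Finset.range (n + 1), (n.choose i : ℝ) * B i * D (n - i), fun x => ?_⟩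
  refine (norm_iteratedFDeriv_smul_le hb hc x (n := n) (mod_cast le_top)).trans ?_
  rw [Finset.sum_mul]
  refine Finset.sum_le_sum fun i hi => ?_
  have hi' : i ≤ n := by simpa [Nat.lt_succ_iff] using hi
  calc _ ≤ (n.choose i : ℝ) * (B i * jap x ^ r) * (D (n - i) * jap x ^ s) := by
        gcongr
        · exact mul_nonneg (by positivity) ((norm_nonneg _).trans (hB i hi' x))
        · exact hB i hi' x
        · exact hD (n - i) (Nat.sub_le _ _) x
    _ = _ := by rw [jap_rpow_add]; ring

namespace IsSymbol

variable {r s : ℝ} {b c : E d → ℂ}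

lemma mul (hb : IsSymbol r b) (hc : IsSymbol s c) : IsSymbol (r + s) (fun x => b x * c x) := by
  refine ⟨hb.contDiff.mul hc.contDiff, fun n => ?_⟩
  choose B hB using hb.bound
  choose D hD using hc.bound
  refine ⟨∑ i ∈ Finset.range (n + 1), (n.choose i : ℝ) * B i * D (n - i), fun x => ?_⟩
  refine (norm_iteratedFDeriv_mul_le hb.contDiff hc.contDiff x (n := n)
    (mod_cast le_top)).trans ?_
  rw [Finset.sum_mul]
  refine Finset.sum_le_sum fun i _ => ?_
  calc _ ≤ (n.choose i : ℝ) * (B i * jap x ^ r) * (D (n - i) * jap x ^ s) := by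
        gcongr
        · exact mul_nonneg (by positivity) ((norm_nonneg _).trans (hB i x))
        · exact hB i x
        · exact hD (n - i) x
    _ = _ := by rw [jap_rpow_add]; ring

lemma comp_left {G : Type*} [NormedAddCommGroup G] [NormedSpace ℝ G] (L : F →L[ℝ] G)
    {b : E d → F} (hb : IsSymbol r b) : IsSymbol r (fun x => L (b x)) := by
  refine ⟨L.contDiff.comp hb.contDiff, fun n => ?_⟩
  obtain ⟨C, hC⟩ := hb.bound n
  refine ⟨‖L‖ * C, fun x => ?_⟩
  refine (L.norm_iteratedFDeriv_comp_left hb.contDiff.contDiffAt (n := n)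
    (mod_cast le_top)).trans ?_
  rw [mul_assoc]
  gcongr
  exact hC x

lemma fderiv {b : E d → F} (hb : IsSymbol r b) : IsSymbol r (fderiv ℝ b) := by
  refine ⟨hb.contDiff.fderiv_right (mod_cast le_top), fun n => ?_⟩
  simpa only [norm_iteratedFDeriv_fderiv] using hb.bound (n + 1)

lemma fderiv_apply {b : E d → F} (hb : IsSymbol r b) (v : E d) :
    IsSymbol r (fun x => _root_.fderiv ℝ b x v) :=
  hb.fderiv.comp_left (ContinuousLinearMap.apply ℝ F v)

lemma const (z : F) : IsSymbol 0 (fun _ : E d => z) := by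
  refine ⟨contDiff_const, fun n => ⟨‖z‖, fun x => ?_⟩⟩
  rcases n with _ | n
  · simp
  · simp [iteratedFDeriv_succ_const]

lemma clm (L : E d →L[ℝ] F) : IsSymbol 1 (fun x => L x) := by
  refine ⟨L.contDiff, fun n => ?_⟩
  rcases n with _ | n
  · refine ⟨‖L‖, fun x => ?_⟩
    rw [norm_iteratedFDeriv_zero, Real.rpow_one]
    exact (L.le_opNorm x).trans (by gcongr; exact norm_le_jap x)
  · have h : (_root_.fderiv ℝ fun x => L x) = fun _ => L := by
      ext1 x; exact L.fderiv
    obtain ⟨C, hC⟩ := ((IsSymbol.const (d := d) L).mono zero_le_one).bound n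
    exact ⟨C, fun x => by rw [← norm_iteratedFDeriv_fderiv, h]; exact hC x⟩

lemma jap_rpow (r : ℝ) : IsSymbol r (fun x : E d => jap x ^ r) := by
  refine ⟨(hasTemperateGrowth_jap_rpow r).1, fun n => ?_⟩
  induction n using Nat.strong_induction_on generalizing r with
  | _ n ih =>
    rcases n with _ | n
    · exact ⟨1, fun x => by simp [abs_of_pos (jap_rpow_pos r x)]⟩
    · have hder : (_root_.fderiv ℝ fun x : E d => jap x ^ r)
          = fun x => jap x ^ (r - 2) • (r • innerSL ℝ) x := by
        ext1 x
        have h1 : HasFDerivAt (fun x : E d => 1 + ‖x‖ ^ 2) (2 • innerSL ℝ x) x :=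
          ((hasStrictFDerivAt_norm_sq x).hasFDerivAt).const_add 1
        have h2 := h1.rpow_const (p := r / 2) (Or.inl (by positivity))
        have h3 : (fun x : E d => jap x ^ r) = fun x => (1 + ‖x‖ ^ 2) ^ (r / 2) := by
          ext y; exact jap_rpow_eq r y
        rw [h3, h2.fderiv, jap_rpow_eq]
        ext y
        simp only [_root_.smul_apply, smul_eq_mul, nsmul_eq_mul]
        rw [show r / 2 - 1 = (r - 2) / 2 by ring]
        push_cast
        simp
        ring
      obtain ⟨C, hC⟩ := norm_iteratedFDeriv_smul_bound
        (hasTemperateGrowth_jap_rpow (r - 2)).1 (IsSymbol.clm (d := d) (r • innerSL ℝ)).contDiff n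
        (fun i hi => ih i (by omega) (r - 2))
        (fun i _ => (IsSymbol.clm (d := d) (r • innerSL ℝ)).bound i)
      refine ⟨|C|, fun x => ?_⟩
      rw [← norm_iteratedFDeriv_fderiv, hder]
      refine (hC x).trans ?_
      have h1 := jap_rpow_pos (r - 2 + 1) x
      have h2 := jap_rpow_mono (show r - 2 + 1 ≤ r by linarith) x
      calc _ ≤ |C| * jap x ^ (r - 2 + 1) := by gcongr; exact le_abs_self C
        _ ≤ _ := by gcongr

lemma ofReal {b : E d → ℝ} (hb : IsSymbol r b) : IsSymbol r (fun x => (b x : ℂ)) :=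
  hb.comp_left Complex.ofRealCLM

lemma coord (j : Fin d) : IsSymbol 1 (fun x : E d => ((x j : ℝ) : ℂ)) :=
  (IsSymbol.clm (EuclideanSpace.proj j : E d →L[ℝ] ℝ)).ofReal

lemma of_homogeneous {m : ℝ} {b : E d → F} (hb : ContDiff ℝ ∞ b)
    (h : ∀ (t : ℝ) (x : E d), 1 ≤ t → 2 < ‖x‖ → b (t • x) = t ^ m • b x) : IsSymbol m b := by
  refine ⟨hb, fun n => ?_⟩
  have hcont : Continuous (iteratedFDeriv ℝ n b) := hb.continuous_iteratedFDeriv (mod_cast le_top)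
  obtain ⟨C, hC⟩ := (isCompact_closedBall (0 : E d) 3).exists_bound_of_continuousOn
    (f := fun x => jap x ^ (-m) • iteratedFDeriv ℝ n b x)
    ((continuous_jap_rpow _).smul hcont).continuousOn
  have hC' : ∀ x : E d, ‖x‖ ≤ 3 → ‖iteratedFDeriv ℝ n b x‖ ≤ |C| * jap x ^ m := by
    intro x hx
    have := hC x (by simpa using hx)
    rw [norm_smul, Real.norm_of_nonneg (jap_rpow_pos _ _).le, Real.rpow_neg (jap_pos x).le,
      inv_mul_le_iff₀ (jap_rpow_pos _ _)] at this
    rw [mul_comm]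
    exact this.trans (by gcongr; exacts [(jap_rpow_pos _ _).le, le_abs_self C])
  refine ⟨|C| * 4 ^ |m|, fun x => ?_⟩
  have h4 : (1 : ℝ) ≤ 4 ^ |m| := Real.one_le_rpow (by norm_num) (abs_nonneg m)
  rcases le_total ‖x‖ 3 with hx | hx
  · refine (hC' x hx).trans ?_
    have := jap_rpow_pos m x
    gcongr
    exact le_mul_of_one_le_right (abs_nonneg C) h4
  · set t := ‖x‖ / 3 with ht
    have ht1 : 1 ≤ t := by rw [ht]; linarith
    have ht0 : 0 < t := by linarith
    set y := t⁻¹ • x with hy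
    have hxy : x = t • y := by rw [hy, smul_smul, mul_inv_cancel₀ ht0.ne', one_smul]
    have hny : ‖y‖ = 3 := by
      rw [hy, norm_smul, norm_inv, Real.norm_of_nonneg ht0.le, ht]
      field_simp
    have hev : (fun z => b (t • z)) =ᶠ[𝓝 y] fun z => t ^ m • b z := by
      filter_upwards [(isOpen_lt continuous_const continuous_norm).mem_nhds
        (show (2 : ℝ) < ‖y‖ by rw [hny]; norm_num)] with z hz using h t z ht1 hz
    have e1 := hev.iteratedFDeriv ℝ n |>.eq_of_nhds
    rw [iteratedFDeriv_comp_const_smul (i := n) t (hb.of_le (mod_cast le_top)),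
      iteratedFDeriv_const_smul_apply' (hb.of_le (mod_cast le_top)).contDiffAt] at e1
    simp only at e1
    rw [← hxy] at e1
    have e2 := congrArg norm e1
    rw [norm_smul, norm_smul, Real.norm_of_nonneg (by positivity),
      Real.norm_of_nonneg (by positivity)] at e2
    have hle : ‖iteratedFDeriv ℝ n b x‖ ≤ t ^ m * ‖iteratedFDeriv ℝ n b y‖ := by
      rw [← e2]
      exact le_mul_of_one_le_left (norm_nonneg _) (one_le_pow₀ ht1)
    refine hle.trans ?_
    have hjx0 := jap_pos x
    have hjy0 := jap_pos y
    have hnx : ‖x‖ = t * 3 := by rw [ht]; ring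
    have hjx : jap x ≤ 4 * t := (jap_le_one_add_norm x).trans (by linarith)
    have hjx' : 3 * t ≤ jap x := by linarith [norm_le_jap x]
    have hjy : jap y ≤ 4 := (jap_le_one_add_norm y).trans (by linarith)
    have hjy' : 3 ≤ jap y := by linarith [norm_le_jap y]
    have key : (t * jap y / jap x) ^ m ≤ 4 ^ |m| := by
      have hq : t * jap y / jap x ≤ 4 := by
        rw [div_le_iff₀ hjx0]; nlinarith
      have hq' : 4⁻¹ ≤ t * jap y / jap x := by
        rw [le_div_iff₀ hjx0]; nlinarith
      rcases le_total 0 m with hm | hm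
      · rw [abs_of_nonneg hm]
        exact Real.rpow_le_rpow (by positivity) hq hm
      · rw [abs_of_nonpos hm, Real.rpow_neg (by norm_num), ← Real.inv_rpow (by norm_num)]
        exact Real.rpow_le_rpow_of_nonpos (by norm_num) hq' hm
    calc t ^ m * ‖iteratedFDeriv ℝ n b y‖ ≤ t ^ m * (|C| * jap y ^ m) := by
          gcongr; exact hC' y hny.le
      _ = |C| * (t * jap y / jap x) ^ m * jap x ^ m := by
          rw [Real.div_rpow (by positivity) hjx0.le, Real.mul_rpow ht0.le hjy0.le]
          field_simp [(jap_rpow_pos m x).ne']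
      _ ≤ _ := by
          have := jap_rpow_pos m x
          gcongr

end IsSymbol

lemma isFourierL2_toLp {f : E d → ℂ} (hf : MemLp f 2 volume) :
    IsFourierL2 f (𝓕 (hf.toLp f) : Lp ℂ 2 (volume : Measure (E d))) := by
  refine ⟨hf, Lp.memLp _, fun φ => ?_⟩
  have h := congrArg (fun T => T φ) (Lp.fourier_toTemperedDistribution_eq (hf.toLp f))
  simp only [TemperedDistribution.fourier_apply, Lp.toTemperedDistribution_apply] at h
  calc ∫ x, f x * 𝓕 (⇑φ) x = ∫ x, (𝓕 φ : 𝓢(E d, ℂ)) x • (hf.toLp f) x := by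
        refine integral_congr_ae ?_
        filter_upwards [hf.coeFn_toLp] with x hx
        rw [hx, smul_eq_mul, mul_comm, SchwartzMap.fourier_coe]
    _ = _ := h
    _ = _ := by simp only [smul_eq_mul, mul_comm]

lemma IsFourierL2.ae_eq {f g₁ g₂ : E d → ℂ} (h₁ : IsFourierL2 f g₁) (h₂ : IsFourierL2 f g₂) :
    g₁ =ᵐ[volume] g₂ := by
  refine ae_eq_of_integral_contDiff_smul_eq (h₁.2.1.locallyIntegrable (by norm_num))
    (h₂.2.1.locallyIntegrable (by norm_num)) fun φ hφ hφc => ?_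
  have hc : HasCompactSupport (fun x => (φ x : ℂ)) := hφc.comp_left (g := ((↑) : ℝ → ℂ)) (by simp)
  have hs : ContDiff ℝ ∞ (fun x => (φ x : ℂ)) := Complex.ofRealCLM.contDiff.comp hφ
  have h := (h₁.2.2 (hc.toSchwartzMap hs)).symm.trans (h₂.2.2 (hc.toSchwartzMap hs))
  simpa [mul_comm] using h

lemma IsFourierL2.eLpNorm_eq {f g : E d → ℂ} (h : IsFourierL2 f g) :
    eLpNorm g 2 volume = eLpNorm f 2 volume := by
  have hf := h.1
  rw [eLpNorm_congr_ae (h.ae_eq (isFourierL2_toLp hf)), ← eLpNorm_congr_ae hf.coeFn_toLp,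
    ← Lp.enorm_def, ← Lp.enorm_def]
  simpa only [ofReal_norm] using congrArg ENNReal.ofReal (Lp.norm_fourier_eq (hf.toLp f))

lemma SchwartzMap.eLpNorm_fourier (f : 𝓢(E d, ℂ)) :
    eLpNorm (𝓕 f : 𝓢(E d, ℂ)) 2 volume = eLpNorm f 2 volume := by
  have h := SchwartzMap.norm_fourier_toL2_eq f
  rw [SchwartzMap.norm_toLp, SchwartzMap.norm_toLp] at h
  exact (ENNReal.toReal_eq_toReal_iff' ((𝓕 f : 𝓢(E d, ℂ)).eLpNorm_lt_top 2 volume).ne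
    (f.eLpNorm_lt_top 2 volume).ne).mp h

/-- The `L²` norm with the weight `⟨ξ⟩^s`. -/
def wnorm (s : ℝ) (f : E d → ℂ) : ℝ≥0∞ := eLpNorm (fun ξ => jap ξ ^ s • f ξ) 2 volume

lemma wnorm_zero (f : E d → ℂ) : wnorm 0 f = eLpNorm f 2 volume := by
  simp [wnorm]

lemma wnorm_le_of_le {s t : ℝ} {C : ℝ} {f g : E d → ℂ}
    (h : ∀ ξ, jap ξ ^ s * ‖f ξ‖ ≤ C * (jap ξ ^ t * ‖g ξ‖)) :
    wnorm s f ≤ ENNReal.ofReal C * wnorm t g := by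
  refine eLpNorm_le_mul_eLpNorm_of_ae_le_mul (Eventually.of_forall fun ξ => ?_) 2
  simpa [norm_smul, abs_of_pos (jap_rpow_pos _ ξ)] using h ξ

lemma wnorm_lt_top (s : ℝ) (f : 𝓢(E d, ℂ)) : wnorm s f < ⊤ := by
  have h := (SchwartzMap.smulLeftCLM ℂ (fun ξ : E d => jap ξ ^ s) f).eLpNorm_lt_top 2 volume
  simpa [wnorm, SchwartzMap.smulLeftCLM_apply (hasTemperateGrowth_jap_rpow s), Pi.smul_def'] using h

lemma aestronglyMeasurable_jap_smul (s : ℝ) {f : E d → ℂ} (hf : AEStronglyMeasurable f volume) :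
    AEStronglyMeasurable (fun ξ => jap ξ ^ s • f ξ) volume :=
  (continuous_jap_rpow s).aestronglyMeasurable.smul hf

lemma wnorm_add_le (s : ℝ) (f g : 𝓢(E d, ℂ)) : wnorm s (⇑(f + g)) ≤ wnorm s f + wnorm s g := by
  have := eLpNorm_add_le (aestronglyMeasurable_jap_smul s f.continuous.aestronglyMeasurable)
    (aestronglyMeasurable_jap_smul s g.continuous.aestronglyMeasurable) (p := 2) (by norm_num)
  simpa [wnorm, Pi.add_def, smul_add] using this

/-- The standard basis vector. -/
abbrev basisVec (j : Fin d) : E d := EuclideanSpace.single j 1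

/-- Multiplication by the `j`-th coordinate. -/
def coordMul (j : Fin d) : 𝓢(E d, ℂ) →L[ℂ] 𝓢(E d, ℂ) :=
  SchwartzMap.smulLeftCLM ℂ (fun ξ : E d => ((ξ j : ℝ) : ℂ))

lemma coordMul_apply (j : Fin d) (f : 𝓢(E d, ℂ)) (ξ : E d) : coordMul j f ξ = (ξ j : ℂ) * f ξ := by
  rw [coordMul, SchwartzMap.smulLeftCLM_apply_apply (IsSymbol.coord j).hasTemperateGrowth,
    smul_eq_mul]

lemma smulLeftCLM_inner_basisVec (j : Fin d) (f : 𝓢(E d, ℂ)) :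
    SchwartzMap.smulLeftCLM ℂ (inner ℝ · (basisVec j)) f = coordMul j f := by
  ext ξ
  rw [SchwartzMap.smulLeftCLM_apply_apply (by fun_prop), coordMul_apply]
  simp [EuclideanSpace.inner_single_right]

/-- The Fourier multiplier `𝓕⁻ ∘ m ∘ 𝓕`. -/
abbrev mult (m : E d → ℂ) : 𝓢(E d, ℂ) →L[ℂ] 𝓢(E d, ℂ) := SchwartzMap.fourierMultiplierCLM ℂ m

lemma fourier_mult_apply {m : E d → ℂ} (hm : m.HasTemperateGrowth) (f : 𝓢(E d, ℂ)) (x : E d) :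
    (𝓕 (mult m f) : 𝓢(E d, ℂ)) x = m x * (𝓕 f : 𝓢(E d, ℂ)) x := by
  rw [SchwartzMap.fourierMultiplierCLM_apply, FourierTransform.fourier_fourierInv_eq,
    SchwartzMap.smulLeftCLM_apply_apply hm, smul_eq_mul]

lemma fourier_injective {f g : 𝓢(E d, ℂ)}
    (h : ∀ x, (𝓕 f : 𝓢(E d, ℂ)) x = (𝓕 g : 𝓢(E d, ℂ)) x) : f = g := by
  have h1 : (𝓕⁻ (𝓕 f : 𝓢(E d, ℂ)) : 𝓢(E d, ℂ)) = f := FourierTransform.fourierInv_fourier_eq f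
  have h2 : (𝓕⁻ (𝓕 g : 𝓢(E d, ℂ)) : 𝓢(E d, ℂ)) = g := FourierTransform.fourierInv_fourier_eq g
  rw [← h1, ← h2, show (𝓕 f : 𝓢(E d, ℂ)) = 𝓕 g from SchwartzMap.ext h]

lemma fourier_coordMul (j : Fin d) (f : 𝓢(E d, ℂ)) :
    (-(2 * Real.pi * Complex.I)) • (𝓕 (coordMul j f) : 𝓢(E d, ℂ))
      = ∂_{basisVec j} (𝓕 f : 𝓢(E d, ℂ)) := by
  rw [SchwartzMap.lineDerivOp_fourier_eq, smulLeftCLM_inner_basisVec,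
    FourierTransform.fourier_smul]

lemma fourier_lineDeriv (j : Fin d) (f : 𝓢(E d, ℂ)) (x : E d) :
    (𝓕 (∂_{basisVec j} f) : 𝓢(E d, ℂ)) x
      = (2 * Real.pi * Complex.I) * ((x j : ℂ) * (𝓕 f : 𝓢(E d, ℂ)) x) := by
  rw [SchwartzMap.fourier_lineDerivOp_eq, smulLeftCLM_inner_basisVec]
  simp [coordMul_apply]

lemma lineDeriv_mult (j : Fin d) {m : E d → ℂ} (hm : m.HasTemperateGrowth) (f : 𝓢(E d, ℂ)) :
    ∂_{basisVec j} (mult m f)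
      = mult (fun x => (2 * Real.pi * Complex.I) * ((x j : ℂ) * m x)) f := by
  have hx := (IsSymbol.coord (d := d) j).hasTemperateGrowth
  apply fourier_injective
  intro x
  rw [fourier_lineDeriv, fourier_mult_apply hm, fourier_mult_apply (by fun_prop)]
  ring

lemma coordMul_mult (j : Fin d) {r : ℝ} {m : E d → ℂ} (hm : IsSymbol r m) (f : 𝓢(E d, ℂ)) :
    coordMul j (mult m f) = mult m (coordMul j f)
      + mult (fun x => (-(2 * Real.pi * Complex.I))⁻¹ * fderiv ℝ m x (basisVec j)) f := by
  have hc : (-(2 * Real.pi * Complex.I)) ≠ 0 := by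
    simp [Real.pi_ne_zero]
  have hm' := (hm.fderiv_apply (basisVec j)).hasTemperateGrowth
  apply fourier_injective
  intro x
  have h1 := congrArg (fun h => h x) (fourier_coordMul j (mult m f))
  have h2 := congrArg (fun h => h x) (fourier_coordMul j f)
  simp only [_root_.smul_apply, smul_eq_mul, SchwartzMap.lineDerivOp_apply_eq_fderiv] at h1 h2
  apply mul_left_cancel₀ hc
  have h3 : ⇑(𝓕 (mult m f) : 𝓢(E d, ℂ)) = fun x => m x * (𝓕 f : 𝓢(E d, ℂ)) x := by
    ext y; exact fourier_mult_apply hm.hasTemperateGrowth f y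
  rw [h1, h3, fderiv_fun_mul (hm.contDiff.differentiable (by simp)).differentiableAt
    (SchwartzMap.differentiableAt _), FourierTransform.fourier_add]
  simp only [_root_.add_apply, _root_.smul_apply, smul_eq_mul]
  rw [fourier_mult_apply hm.hasTemperateGrowth, fourier_mult_apply (by fun_prop), ← h2, mul_add]
  field_simp

lemma wnorm_congr_le {s t : ℝ} {C : ℝ≥0} {f g : E d → ℂ}
    (h : ∀ ξ, jap ξ ^ s * ‖f ξ‖ ≤ C * (jap ξ ^ t * ‖g ξ‖)) : wnorm s f ≤ C * wnorm t g := by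
  simpa using wnorm_le_of_le h

lemma mult_bound_zero {m : E d → ℂ} (hm : IsSymbol 0 m) :
    ∃ C : ℝ≥0, ∀ f : 𝓢(E d, ℂ), wnorm 0 (mult m f) ≤ C * wnorm 0 f := by
  obtain ⟨C, hC⟩ := hm.norm_le
  refine ⟨C, fun f => ?_⟩
  rw [wnorm_zero, ← SchwartzMap.eLpNorm_fourier, wnorm_zero, ← SchwartzMap.eLpNorm_fourier f,
    ← wnorm_zero, ← wnorm_zero]
  refine wnorm_congr_le fun ξ => ?_
  rw [fourier_mult_apply hm.hasTemperateGrowth]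
  have := hC ξ
  simp only [Real.rpow_zero, mul_one, one_mul, norm_mul] at this ⊢
  gcongr

lemma abs_coord_le_jap (ξ : E d) (j : Fin d) : |ξ j| ≤ jap ξ :=
  (EuclideanSpace.norm_eq ξ ▸ PiLp.norm_apply_le ξ j : ‖ξ j‖ ≤ ‖ξ‖).trans (norm_le_jap ξ)

lemma wnorm_coordMul_le (s : ℝ) (j : Fin d) (f : 𝓢(E d, ℂ)) :
    wnorm s (coordMul j f) ≤ wnorm (s + 1) f := by
  have h : wnorm s (coordMul j f) ≤ (1 : ℝ≥0) * wnorm (s + 1) f := by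
    refine wnorm_congr_le fun ξ => ?_
    rw [coordMul_apply, norm_mul, jap_rpow_add, Real.rpow_one]
    have h1 := abs_coord_le_jap ξ j
    have h2 := jap_rpow_pos s ξ
    simp only [Complex.norm_real, Real.norm_eq_abs, NNReal.coe_one, one_mul]
    calc _ ≤ jap ξ ^ s * (jap ξ * ‖f ξ‖) := by gcongr
      _ = _ := by ring
  simpa using h

lemma wnorm_mono {s t : ℝ} (hst : s ≤ t) (f : E d → ℂ) : wnorm s f ≤ wnorm t f := by
  have h : wnorm s f ≤ (1 : ℝ≥0) * wnorm t f := by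
    refine wnorm_congr_le fun ξ => ?_
    have := jap_rpow_mono hst ξ
    simp only [NNReal.coe_one, one_mul]
    gcongr
  simpa using h

lemma jap_le_one_add_sum (ξ : E d) : jap ξ ≤ 1 + ∑ j, |ξ j| := by
  rw [jap, Real.sqrt_le_left (by positivity), EuclideanSpace.norm_sq_eq]
  have h : ∑ j, ‖ξ j‖ ^ 2 ≤ (∑ j, |ξ j|) ^ 2 := by
    simpa using Finset.sum_sq_le_sq_sum_of_nonneg (s := Finset.univ) (f := fun j => |ξ j|)
      (fun j _ => abs_nonneg _)
  have : 0 ≤ ∑ j, |ξ j| := by positivity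
  nlinarith

lemma wnorm_succ_le (s : ℝ) (f : 𝓢(E d, ℂ)) :
    wnorm (s + 1) f ≤ wnorm s f + ∑ j, wnorm s (coordMul j f) := by
  have hmeas : ∀ g : 𝓢(E d, ℂ), AEStronglyMeasurable (fun ξ => ‖jap ξ ^ s • g ξ‖) volume :=
    fun g => (aestronglyMeasurable_jap_smul s g.continuous.aestronglyMeasurable).norm
  have h1 : wnorm (s + 1) f ≤ eLpNorm ((fun ξ => ‖jap ξ ^ s • f ξ‖)
      + ∑ j, fun ξ => ‖jap ξ ^ s • coordMul j f ξ‖) 2 volume := by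
    refine eLpNorm_mono_real fun ξ => ?_
    simp only [Pi.add_apply, Finset.sum_apply, norm_smul, coordMul_apply, norm_mul,
      Real.norm_of_nonneg (jap_rpow_pos _ ξ).le, Complex.norm_real, Real.norm_eq_abs]
    have h2 := jap_rpow_pos s ξ
    rw [jap_rpow_add, Real.rpow_one]
    calc jap ξ ^ s * jap ξ * ‖f ξ‖ ≤ jap ξ ^ s * (1 + ∑ j, |ξ j|) * ‖f ξ‖ := by
          gcongr; exact jap_le_one_add_sum ξ
      _ = _ := by
          simp only [mul_add, add_mul, mul_one, Finset.mul_sum, Finset.sum_mul, mul_assoc,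
            abs_of_pos h2]
  refine h1.trans ((eLpNorm_add_le (hmeas f) (Finset.aestronglyMeasurable_sum _
    fun j _ => hmeas _) (by norm_num)).trans ?_)
  gcongr
  · rw [eLpNorm_norm]; rfl
  · refine (eLpNorm_sum_le (fun j _ => hmeas _) (by norm_num)).trans (Finset.sum_le_sum fun j _ => ?_)
    rw [eLpNorm_norm]; rfl

lemma mult_bound_nat (k : ℕ) : ∀ {m : E d → ℂ}, IsSymbol 0 m →
    ∃ C : ℝ≥0, ∀ f : 𝓢(E d, ℂ), wnorm k (mult m f) ≤ C * wnorm k f := by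
  induction k with
  | zero => intro m hm; simpa using mult_bound_zero hm
  | succ k ih =>
    intro m hm
    obtain ⟨C, hC⟩ := ih hm
    have hd : ∀ j, IsSymbol 0
        (fun x => (-(2 * Real.pi * Complex.I))⁻¹ * fderiv ℝ m x (basisVec j)) := fun j => by
      simpa using (IsSymbol.const (d := d) (-(2 * Real.pi * Complex.I))⁻¹).mul
        (hm.fderiv_apply (basisVec j))
    choose D hD using fun j => ih (hd j)
    refine ⟨C + ∑ j, (C + D j), fun f => ?_⟩
    push_cast
    rw [add_mul, Finset.sum_mul]
    have hle : wnorm (k : ℝ) f ≤ wnorm ((k : ℝ) + 1) f := wnorm_mono (by linarith) f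
    refine (wnorm_succ_le _ _).trans ?_
    gcongr with j
    · exact (hC f).trans (by gcongr)
    · rw [coordMul_mult j hm, add_mul]
      refine (wnorm_add_le _ _ _).trans ?_
      gcongr
      · exact (hC _).trans (by gcongr; exact wnorm_coordMul_le _ _ _)
      · exact (hD j _).trans (by gcongr)

lemma wnorm_sq (s : ℝ) (f : E d → ℂ) :
    wnorm s f ^ 2 = ∫⁻ ξ, ENNReal.ofReal (jap ξ ^ (2 * s) * ‖f ξ‖ ^ 2) := by
  have h := eLpNorm_nnreal_pow_eq_lintegral (μ := (volume : Measure (E d)))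
    (f := fun ξ => jap ξ ^ s • f ξ) (p := 2) (by norm_num)
  simp only [NNReal.coe_ofNat, ENNReal.coe_ofNat, ENNReal.rpow_ofNat] at h
  rw [wnorm, h]
  congr 1
  ext ξ
  rw [← ofReal_norm, ← ENNReal.ofReal_pow (norm_nonneg _), norm_smul, mul_pow,
    Real.norm_of_nonneg (jap_rpow_pos _ _).le, ← Real.rpow_natCast, ← Real.rpow_mul (jap_pos ξ).le]
  congr 3
  push_cast; ring

/-- The truncated weight used for interpolation. -/
def truncWeight (κ a R : ℝ) : ℝ := min 1 ((a / R) ^ κ)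

lemma lintegral_Ioi_mul_rpow {κ p a : ℝ} (hpκ : p < κ) (ha0 : 0 < a) :
    ∫⁻ R in Set.Ioi a, ENNReal.ofReal (a ^ κ * R ^ (p - 1 - κ)) =
      ENNReal.ofReal (a ^ p / (κ - p)) := by
  rw [← ofReal_integral_eq_lintegral_ofReal]
  · rw [integral_const_mul, integral_Ioi_rpow_of_lt (by linarith) ha0]
    congr 1
    rw [show p - 1 - κ + 1 = p - κ by ring, Real.rpow_sub ha0]
    have : κ - p ≠ 0 := by linarith
    have : p - κ ≠ 0 := by intro h; apply this; linarith
    have := (Real.rpow_pos_of_pos ha0 κ).ne'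
    field_simp
    ring
  · exact (integrableOn_Ioi_rpow_of_lt (by linarith) ha0).const_mul _
  · filter_upwards [ae_restrict_mem measurableSet_Ioi] with R hR
    have : 0 < R := ha0.trans hR
    simp only [Pi.zero_apply]
    positivity

lemma lintegral_truncWeight_ge {κ p a : ℝ} (hp : 0 < p) (hpκ : p < κ) (ha : 1 ≤ a) :
    ENNReal.ofReal (a ^ p / (κ - p)) ≤
      ∫⁻ R in Set.Ioi (1 : ℝ), ENNReal.ofReal (R ^ (p - 1) * truncWeight κ a R) := by
  have ha0 : 0 < a := by linarith
  rw [← lintegral_Ioi_mul_rpow hpκ ha0]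
  refine (setLIntegral_mono' measurableSet_Ioi fun R hR => ?_).trans
    (lintegral_mono_set (Set.Ioi_subset_Ioi ha))
  have hR0 : 0 < R := ha0.trans hR
  apply ENNReal.ofReal_le_ofReal
  rw [Real.rpow_sub hR0, truncWeight, Real.div_rpow ha0.le hR0.le, min_eq_right_of_lt]
  · apply le_of_eq; ring
  · rw [div_lt_one (by positivity)]
    exact Real.rpow_lt_rpow ha0.le hR (by linarith)


lemma lintegral_truncWeight_le {κ p a : ℝ} (hp : 0 < p) (hpκ : p < κ) (ha : 1 ≤ a) :
    ∫⁻ R in Set.Ioi (1 : ℝ), ENNReal.ofReal (R ^ (p - 1) * truncWeight κ a R) ≤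
      ENNReal.ofReal ((1 / p + 1 / (κ - p)) * a ^ p) := by
  have ha0 : 0 < a := by linarith
  have hκp : 0 < κ - p := by linarith
  have h1 : ∫⁻ R in Set.Ioi a, ENNReal.ofReal (a ^ κ * R ^ (p - 1 - κ)) =
      ENNReal.ofReal (a ^ p / (κ - p)) := lintegral_Ioi_mul_rpow hpκ ha0
  have h2 : ∫⁻ R in Set.Ioc 0 a, ENNReal.ofReal (R ^ (p - 1)) = ENNReal.ofReal (a ^ p / p) := by
    rw [← ofReal_integral_eq_lintegral_ofReal]
    · rw [← intervalIntegral.integral_of_le ha0.le, integral_rpow (Or.inl (by linarith))]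
      simp [hp.ne']
    · exact (intervalIntegrable_iff_integrableOn_Ioc_of_le ha0.le).1
        (intervalIntegral.intervalIntegrable_rpow' (by linarith))
    · filter_upwards [ae_restrict_mem measurableSet_Ioc] with R hR
      have : 0 < R := hR.1
      simp only [Pi.zero_apply]
      positivity
  have hsub : Set.Ioi (1 : ℝ) ⊆ Set.Ioc 0 a ∪ Set.Ioi a := fun R hR => by
    rcases le_or_gt R a with h | h
    · exact Or.inl ⟨one_pos.trans hR, h⟩
    · exact Or.inr h
  calc _ ≤ ∫⁻ R in Set.Ioc 0 a ∪ Set.Ioi a, ENNReal.ofReal (R ^ (p - 1) * truncWeight κ a R) :=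
        lintegral_mono_set hsub
    _ ≤ (∫⁻ R in Set.Ioc 0 a, ENNReal.ofReal (R ^ (p - 1) * truncWeight κ a R))
        + ∫⁻ R in Set.Ioi a, ENNReal.ofReal (R ^ (p - 1) * truncWeight κ a R) :=
        lintegral_union_le _ _ _
    _ ≤ (∫⁻ R in Set.Ioc 0 a, ENNReal.ofReal (R ^ (p - 1)))
        + ∫⁻ R in Set.Ioi a, ENNReal.ofReal (a ^ κ * R ^ (p - 1 - κ)) := by
        refine add_le_add (setLIntegral_mono' measurableSet_Ioc fun R hR => ?_)
          (setLIntegral_mono' measurableSet_Ioi fun R hR => ?_)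
        · apply ENNReal.ofReal_le_ofReal
          have : 0 < R := hR.1
          exact mul_le_of_le_one_right (by positivity) (min_le_left _ _)
        · have hR0 : 0 < R := ha0.trans hR
          apply ENNReal.ofReal_le_ofReal
          rw [Real.rpow_sub hR0 (p - 1)]
          calc _ ≤ R ^ (p - 1) * (a / R) ^ κ := by
                gcongr; exact min_le_right _ _
            _ = _ := by rw [Real.div_rpow ha0.le hR0.le]; ring
    _ = _ := by
        rw [h1, h2, ← ENNReal.ofReal_add (by positivity) (by positivity)]
        congr 1; ring

lemma truncWeight_nonneg {κ a R : ℝ} (ha : 0 ≤ a) (hR : 0 ≤ R) : 0 ≤ truncWeight κ a R :=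
  le_min zero_le_one (Real.rpow_nonneg (div_nonneg ha hR) κ)

lemma measurable_truncWeight (κ : ℝ) :
    Measurable (fun q : E d × ℝ => truncWeight κ (jap q.1) q.2) := by
  have h1 : Measurable (fun q : E d × ℝ => jap q.1) := continuous_jap.measurable.comp measurable_fst
  exact measurable_const.min ((h1.div measurable_snd).pow_const κ)

lemma lintegral_truncWeight_swap (κ p : ℝ) {f : E d → ℂ} (hf : Continuous f) :
    ∫⁻ ξ, (∫⁻ R in Set.Ioi (1 : ℝ), ENNReal.ofReal (R ^ (p - 1) * truncWeight κ (jap ξ) R))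
        * ENNReal.ofReal (‖f ξ‖ ^ 2)
      = ∫⁻ R in Set.Ioi (1 : ℝ), ENNReal.ofReal (R ^ (p - 1)) *
          ∫⁻ ξ, ENNReal.ofReal (truncWeight κ (jap ξ) R * ‖f ξ‖ ^ 2) := by
  have hm := measurable_truncWeight (d := d) κ
  have hp : Measurable (fun q : E d × ℝ => q.2 ^ (p - 1)) := measurable_snd.pow_const _
  have hf' : Measurable (fun q : E d × ℝ => ‖f q.1‖ ^ 2) :=
    (hf.norm.pow 2).measurable.comp measurable_fst
  calc _ = ∫⁻ ξ, ∫⁻ R in Set.Ioi (1 : ℝ), ENNReal.ofReal (R ^ (p - 1) * truncWeight κ (jap ξ) R)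
          * ENNReal.ofReal (‖f ξ‖ ^ 2) := by
        congr 1 with ξ
        rw [lintegral_mul_const]
        exact ((hp.mul hm).comp measurable_prodMk_left).ennreal_ofReal
    _ = ∫⁻ R in Set.Ioi (1 : ℝ), ∫⁻ ξ, ENNReal.ofReal (R ^ (p - 1) * truncWeight κ (jap ξ) R)
          * ENNReal.ofReal (‖f ξ‖ ^ 2) := by
        refine lintegral_lintegral_swap ?_
        exact ((hp.mul hm).ennreal_ofReal.mul hf'.ennreal_ofReal).aemeasurable
    _ = _ := by
        refine setLIntegral_congr_fun measurableSet_Ioi fun R hR => ?_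
        have hR0 : 0 < R := one_pos.trans hR
        rw [← lintegral_const_mul]
        · congr 1 with ξ
          have := truncWeight_nonneg (κ := κ) (jap_pos ξ).le hR0.le
          rw [ENNReal.ofReal_mul (by positivity), ENNReal.ofReal_mul (by positivity), mul_assoc]
        · exact ((hm.mul hf').comp measurable_prodMk_right).ennreal_ofReal

lemma wnorm_sq_le_lintegral_truncWeight {s κ : ℝ} (hs : 0 < s) (hκ : 2 * s < κ) (f : E d → ℂ) :
    wnorm s f ^ 2 ≤ ENNReal.ofReal (κ - 2 * s) *
      ∫⁻ ξ, (∫⁻ R in Set.Ioi (1 : ℝ), ENNReal.ofReal (R ^ (2 * s - 1) * truncWeight κ (jap ξ) R))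
        * ENNReal.ofReal (‖f ξ‖ ^ 2) := by
  rw [wnorm_sq, ← lintegral_const_mul' _ _ ENNReal.ofReal_ne_top]
  refine lintegral_mono fun ξ => ?_
  have h : 0 < κ - 2 * s := by linarith
  have := jap_rpow_pos (2 * s) ξ
  rw [← mul_assoc, ENNReal.ofReal_mul this.le]
  gcongr
  calc ENNReal.ofReal (jap ξ ^ (2 * s))
      = ENNReal.ofReal (κ - 2 * s) * ENNReal.ofReal (jap ξ ^ (2 * s) / (κ - 2 * s)) := by
        rw [← ENNReal.ofReal_mul h.le, mul_div_cancel₀ _ h.ne']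
    _ ≤ _ := by
        gcongr
        exact lintegral_truncWeight_ge (by linarith) hκ (one_le_jap ξ)

lemma lintegral_truncWeight_le_wnorm_sq {s κ : ℝ} (hs : 0 < s) (hκ : 2 * s < κ) (f : E d → ℂ) :
    ∫⁻ ξ, (∫⁻ R in Set.Ioi (1 : ℝ), ENNReal.ofReal (R ^ (2 * s - 1) * truncWeight κ (jap ξ) R))
        * ENNReal.ofReal (‖f ξ‖ ^ 2)
      ≤ ENNReal.ofReal (1 / (2 * s) + 1 / (κ - 2 * s)) * wnorm s f ^ 2 := by
  rw [wnorm_sq, ← lintegral_const_mul' _ _ ENNReal.ofReal_ne_top]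
  refine lintegral_mono fun ξ => ?_
  have h : 0 < κ - 2 * s := by linarith
  have := jap_rpow_pos (2 * s) ξ
  rw [ENNReal.ofReal_mul this.le, ← mul_assoc, ← ENNReal.ofReal_mul (by positivity)]
  gcongr
  exact lintegral_truncWeight_le (by linarith) hκ (one_le_jap ξ)

lemma exists_cutoff {R R' : ℝ} (hR : 0 < R) (hRR' : R < R') :
    ∃ χ : E d → ℝ, ContDiff ℝ ∞ χ ∧ HasCompactSupport χ ∧ (∀ ξ, 0 ≤ χ ξ ∧ χ ξ ≤ 1) ∧
      (∀ ξ, ‖ξ‖ ≤ R → χ ξ = 1) ∧ ∀ ξ, R' ≤ ‖ξ‖ → χ ξ = 0 := by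
  let b : ContDiffBump (0 : E d) := ⟨R, R', hR, hRR'⟩
  refine ⟨b, b.contDiff, b.hasCompactSupport, fun ξ => ⟨b.nonneg, b.le_one⟩, fun ξ h => ?_,
    fun ξ h => ?_⟩
  · exact b.one_of_mem_closedBall (by simpa using h)
  · exact b.zero_of_le_dist (by simpa using h)

lemma hasTemperateGrowth_of_hasCompactSupport {χ : E d → F} (h : ContDiff ℝ ∞ χ)
    (hc : HasCompactSupport χ) : χ.HasTemperateGrowth :=
  (hc.toSchwartzMap h).hasTemperateGrowth

lemma truncWeight_mult_bound {m : E d → ℂ} (hm : IsSymbol 0 m) (k : ℕ) :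
    ∃ M : ℝ≥0, ∀ R : ℝ, 1 < R → ∀ f : 𝓢(E d, ℂ),
      ∫⁻ ξ, ENNReal.ofReal (truncWeight (2 * k) (jap ξ) R * ‖mult m f ξ‖ ^ 2) ≤
        M * ∫⁻ ξ, ENNReal.ofReal (truncWeight (2 * k) (jap ξ) R * ‖f ξ‖ ^ 2) := by
  obtain ⟨C, hC⟩ := mult_bound_nat k hm
  obtain ⟨D, hD⟩ := mult_bound_zero hm
  refine ⟨2 * C ^ 2 * 3 ^ (2 * k) + 2 * D ^ 2, fun R hR f => ?_⟩
  have hR0 : 0 < R := by linarith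
  obtain ⟨χ, hχ, hχc, hχ01, hχ1, hχ0⟩ := exists_cutoff (d := d) hR0 (by linarith : R < 2 * R)
  have hχt := hasTemperateGrowth_of_hasCompactSupport hχ hχc
  set f₁ : 𝓢(E d, ℂ) := SchwartzMap.smulLeftCLM ℂ χ f with hf₁
  have hf₁x : ∀ ξ, f₁ ξ = χ ξ • f ξ := fun ξ => SchwartzMap.smulLeftCLM_apply_apply hχt f ξ
  set f₂ : 𝓢(E d, ℂ) := f - f₁ with hf₂
  have hf₂x : ∀ ξ, f₂ ξ = (1 - χ ξ) • f ξ := fun ξ => by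
    rw [hf₂, sub_apply, hf₁x, sub_smul, one_smul]
  have hRk : 0 < R ^ (2 * (k : ℝ)) := Real.rpow_pos_of_pos hR0 _
  set A := ∫⁻ ξ, ENNReal.ofReal (truncWeight (2 * k) (jap ξ) R * ‖f ξ‖ ^ 2) with hA
  have low : wnorm k f₁ ^ 2 ≤ ENNReal.ofReal (R ^ (2 * (k : ℝ)) * 3 ^ (2 * k)) * A := by
    rw [wnorm_sq, hA, ← lintegral_const_mul' _ _ ENNReal.ofReal_ne_top]
    refine lintegral_mono fun ξ => ?_
    rw [← ENNReal.ofReal_mul (by positivity)]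
    apply ENNReal.ofReal_le_ofReal
    have hK := truncWeight_nonneg (κ := 2 * k) (jap_pos ξ).le hR0.le
    rcases le_or_gt (2 * R) ‖ξ‖ with h | h
    · rw [hf₁x, hχ0 ξ h]
      simp only [zero_smul, norm_zero, ne_eq, OfNat.ofNat_ne_zero, not_false_eq_true, zero_pow,
        mul_zero]
      positivity
    · have h1 : jap ξ / R ≤ 3 := by
        rw [div_le_iff₀ hR0]; linarith [jap_le_one_add_norm ξ]
      have h2 : (jap ξ / R) ^ (2 * (k : ℝ)) ≤ 3 ^ (2 * k) := by
        have := Real.rpow_le_rpow (div_nonneg (jap_pos ξ).le hR0.le) h1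
          (by positivity : 0 ≤ 2 * (k : ℝ))
        refine this.trans_eq ?_
        rw [← Real.rpow_natCast]; push_cast; rfl
      have h3 : (1 : ℝ) ≤ 3 ^ (2 * k) := one_le_pow₀ (by norm_num)
      have h4 : (jap ξ / R) ^ (2 * (k : ℝ)) ≤ 3 ^ (2 * k) * truncWeight (2 * k) (jap ξ) R := by
        have : 0 ≤ (jap ξ / R) ^ (2 * (k : ℝ)) :=
          Real.rpow_nonneg (div_nonneg (jap_pos ξ).le hR0.le) _
        rw [truncWeight, mul_min_of_nonneg _ _ (by positivity)]
        exact le_min (by simpa using h2) (le_mul_of_one_le_left this h3)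
      have h5 : ‖f₁ ξ‖ ≤ ‖f ξ‖ := by
        rw [hf₁x, norm_smul, Real.norm_of_nonneg (hχ01 ξ).1]
        exact mul_le_of_le_one_left (norm_nonneg _) (hχ01 ξ).2
      have h6 : jap ξ ^ (2 * (k : ℝ)) = R ^ (2 * (k : ℝ)) * (jap ξ / R) ^ (2 * (k : ℝ)) := by
        rw [Real.div_rpow (jap_pos ξ).le hR0.le, mul_div_cancel₀ _ hRk.ne']
      calc jap ξ ^ (2 * (k : ℝ)) * ‖f₁ ξ‖ ^ 2
          ≤ (R ^ (2 * (k : ℝ)) * (3 ^ (2 * k) * truncWeight (2 * k) (jap ξ) R)) * ‖f ξ‖ ^ 2 := by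
            rw [h6]; gcongr
        _ = _ := by ring
  have high : wnorm 0 f₂ ^ 2 ≤ A := by
    rw [wnorm_sq, hA]
    refine lintegral_mono fun ξ => ENNReal.ofReal_le_ofReal ?_
    rw [mul_zero, Real.rpow_zero, one_mul]
    have hK := truncWeight_nonneg (κ := 2 * k) (jap_pos ξ).le hR0.le
    rcases le_or_gt ‖ξ‖ R with h | h
    · rw [hf₂x, hχ1 ξ h]
      simp only [sub_self, zero_smul, norm_zero, ne_eq, OfNat.ofNat_ne_zero, not_false_eq_true,
        zero_pow]
      positivity
    · have h1 : 1 ≤ jap ξ / R := by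
        rw [le_div_iff₀ hR0]; linarith [norm_le_jap ξ]
      rw [truncWeight, min_eq_left (Real.one_le_rpow h1 (by positivity)), one_mul]
      gcongr
      rw [hf₂x, norm_smul, Real.norm_of_nonneg (by linarith [(hχ01 ξ).2])]
      exact mul_le_of_le_one_left (norm_nonneg _) (by linarith [(hχ01 ξ).1])
  have split : ∀ ξ, mult m f ξ = mult m f₁ ξ + mult m f₂ ξ := fun ξ => by
    rw [← add_apply, ← map_add, hf₂, add_sub_cancel]
  calc ∫⁻ ξ, ENNReal.ofReal (truncWeight (2 * k) (jap ξ) R * ‖mult m f ξ‖ ^ 2)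
      ≤ ∫⁻ ξ, (ENNReal.ofReal (2 * (R ^ (2 * (k : ℝ)))⁻¹) *
            ENNReal.ofReal (jap ξ ^ (2 * (k : ℝ)) * ‖mult m f₁ ξ‖ ^ 2)
          + ENNReal.ofReal 2 * ENNReal.ofReal (jap ξ ^ (2 * (0 : ℝ)) * ‖mult m f₂ ξ‖ ^ 2)) := by
        refine lintegral_mono fun ξ => ?_
        have hj := jap_rpow_pos (2 * (k : ℝ)) ξ
        rw [← ENNReal.ofReal_mul (by positivity), mul_zero, Real.rpow_zero, one_mul,
          ← ENNReal.ofReal_mul (by positivity),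
          ← ENNReal.ofReal_add (by positivity) (by positivity)]
        apply ENNReal.ofReal_le_ofReal
        have hK := truncWeight_nonneg (κ := 2 * k) (jap_pos ξ).le hR0.le
        have hK1 : truncWeight (2 * k) (jap ξ) R ≤ 1 := min_le_left _ _
        have hK2 : truncWeight (2 * k) (jap ξ) R
            ≤ (R ^ (2 * (k : ℝ)))⁻¹ * jap ξ ^ (2 * (k : ℝ)) := by
          refine (min_le_right _ _).trans_eq ?_
          rw [Real.div_rpow (jap_pos ξ).le hR0.le, div_eq_inv_mul]
        have hsq : ‖mult m f ξ‖ ^ 2 ≤ 2 * ‖mult m f₁ ξ‖ ^ 2 + 2 * ‖mult m f₂ ξ‖ ^ 2 := by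
          have h1 := norm_add_le (mult m f₁ ξ) (mult m f₂ ξ)
          rw [← split] at h1
          nlinarith [norm_nonneg (mult m f ξ), sq_nonneg (‖mult m f₁ ξ‖ - ‖mult m f₂ ξ‖)]
        calc _ ≤ truncWeight (2 * k) (jap ξ) R * (2 * ‖mult m f₁ ξ‖ ^ 2 + 2 * ‖mult m f₂ ξ‖ ^ 2) := by
              gcongr
          _ = truncWeight (2 * k) (jap ξ) R * (2 * ‖mult m f₁ ξ‖ ^ 2)
              + truncWeight (2 * k) (jap ξ) R * (2 * ‖mult m f₂ ξ‖ ^ 2) := by ring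
          _ ≤ ((R ^ (2 * (k : ℝ)))⁻¹ * jap ξ ^ (2 * (k : ℝ))) * (2 * ‖mult m f₁ ξ‖ ^ 2)
              + 1 * (2 * ‖mult m f₂ ξ‖ ^ 2) := by gcongr
          _ = _ := by ring
    _ = ENNReal.ofReal (2 * (R ^ (2 * (k : ℝ)))⁻¹) * wnorm k (mult m f₁) ^ 2
          + ENNReal.ofReal 2 * wnorm 0 (mult m f₂) ^ 2 := by
        rw [lintegral_add_right, lintegral_const_mul' _ _ ENNReal.ofReal_ne_top,
          lintegral_const_mul' _ _ ENNReal.ofReal_ne_top, wnorm_sq, wnorm_sq]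
        exact (((continuous_jap_rpow _).mul
          ((mult m f₂).continuous.norm.pow 2)).measurable.ennreal_ofReal).const_mul _
    _ ≤ ENNReal.ofReal (2 * (R ^ (2 * (k : ℝ)))⁻¹) * (C ^ 2 *
          (ENNReal.ofReal (R ^ (2 * (k : ℝ)) * 3 ^ (2 * k)) * A)) + ENNReal.ofReal 2 * (D ^ 2 * A) := by
        gcongr
        · calc _ ≤ (C * wnorm k f₁) ^ 2 := by gcongr; exact hC _
            _ ≤ _ := by rw [mul_pow]; gcongr
        · calc _ ≤ (D * wnorm 0 f₂) ^ 2 := by gcongr; exact hD _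
            _ ≤ _ := by rw [mul_pow]; gcongr
    _ = _ := by
        have : ENNReal.ofReal (2 * (R ^ (2 * (k : ℝ)))⁻¹) *
            ENNReal.ofReal (R ^ (2 * (k : ℝ)) * 3 ^ (2 * k)) = 2 * 3 ^ (2 * k) := by
          rw [← ENNReal.ofReal_mul (by positivity)]
          rw [show 2 * (R ^ (2 * (k : ℝ)))⁻¹ * (R ^ (2 * (k : ℝ)) * 3 ^ (2 * k))
            = 2 * 3 ^ (2 * k) by field_simp]
          rw [ENNReal.ofReal_mul (by positivity), ENNReal.ofReal_pow (by positivity)]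
          simp
        rw [ENNReal.ofReal_ofNat]
        push_cast
        calc _ = (ENNReal.ofReal (2 * (R ^ (2 * (k : ℝ)))⁻¹) *
            ENNReal.ofReal (R ^ (2 * (k : ℝ)) * 3 ^ (2 * k))) * C ^ 2 * A + 2 * D ^ 2 * A := by ring
          _ = _ := by rw [this]; ring

lemma mult_bound_nonneg {s : ℝ} (hs : 0 ≤ s) {m : E d → ℂ} (hm : IsSymbol 0 m) :
    ∃ C : ℝ≥0, ∀ f : 𝓢(E d, ℂ), wnorm s (mult m f) ≤ C * wnorm s f := by
  rcases hs.eq_or_lt with rfl | hs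
  · exact mult_bound_zero hm
  obtain ⟨k, hk⟩ := exists_nat_gt s
  obtain ⟨M, hM⟩ := truncWeight_mult_bound hm k
  have hκ : 2 * s < 2 * (k : ℝ) := by linarith
  set c : ℝ := (2 * k - 2 * s) * (1 / (2 * s) + 1 / (2 * k - 2 * s)) with hc
  have hks : 0 < 2 * (k : ℝ) - 2 * s := by linarith
  have hc0 : 0 ≤ c := by positivity
  refine ⟨NNReal.sqrt (M * c.toNNReal), fun f => ?_⟩
  have key : wnorm s (mult m f) ^ 2 ≤ (M * c.toNNReal : ℝ≥0) * wnorm s f ^ 2 := by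
    calc _ ≤ ENNReal.ofReal (2 * k - 2 * s) * _ :=
          wnorm_sq_le_lintegral_truncWeight hs hκ _
      _ ≤ ENNReal.ofReal (2 * k - 2 * s) * (M * (ENNReal.ofReal (1 / (2 * s) + 1 / (2 * k - 2 * s))
          * wnorm s f ^ 2)) := by
          gcongr
          refine le_trans ?_ (mul_le_mul_right (lintegral_truncWeight_le_wnorm_sq hs hκ f) _)
          rw [lintegral_truncWeight_swap _ _ (mult m f).continuous,
            lintegral_truncWeight_swap _ _ f.continuous, ← lintegral_const_mul' _ _ (by simp)]
          refine setLIntegral_mono' measurableSet_Ioi fun R hR => ?_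
          rw [mul_left_comm]
          gcongr
          exact hM R hR f
      _ = (ENNReal.ofReal (2 * k - 2 * s) * ENNReal.ofReal (1 / (2 * s) + 1 / (2 * k - 2 * s)))
            * M * wnorm s f ^ 2 := by ring
      _ = _ := by
          rw [← ENNReal.ofReal_mul hks.le, ← hc, ENNReal.ofReal]
          push_cast; ring
  rw [← ENNReal.pow_le_pow_left_iff (n := 2) (by norm_num), mul_pow]
  refine key.trans_eq ?_
  rw [← ENNReal.coe_pow, NNReal.sq_sqrt]

lemma enorm_integral_mul_le (s : ℝ) {f g : E d → ℂ} (hf : AEStronglyMeasurable f volume)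
    (hg : AEStronglyMeasurable g volume) :
    ‖∫ ξ, f ξ * g ξ‖ₑ ≤ wnorm (-s) f * wnorm s g := by
  have h := eLpNorm_smul_le_mul_eLpNorm (p := 2) (q := 2) (r := 1)
    (aestronglyMeasurable_jap_smul s hg) (aestronglyMeasurable_jap_smul (-s) hf)
  refine le_trans ?_ h
  rw [eLpNorm_one_eq_lintegral_enorm]
  refine (enorm_integral_le_lintegral_enorm _).trans_eq (lintegral_congr fun ξ => ?_)
  congr 1
  have : jap ξ ^ (-s) * jap ξ ^ s = 1 := by rw [← jap_rpow_add]; simp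
  simp only [Pi.smul_apply', smul_eq_mul, Complex.real_smul]
  calc f ξ * g ξ = ((jap ξ ^ (-s) * jap ξ ^ s : ℝ) : ℂ) * (f ξ * g ξ) := by rw [this]; simp
    _ = _ := by push_cast; ring

lemma IsSymbol.conj {r : ℝ} {m : E d → ℂ} (hm : IsSymbol r m) :
    IsSymbol r (fun x => starRingEnd ℂ (m x)) :=
  hm.comp_left (Complex.conjCLE : ℂ →L[ℝ] ℂ)

lemma integral_inner_mult {m : E d → ℂ} {r : ℝ} (hm : IsSymbol r m) (f ψ : 𝓢(E d, ℂ)) :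
    ∫ ξ, inner ℂ (mult m f ξ) (ψ ξ) =
      ∫ ξ, inner ℂ (f ξ) (mult (fun x => starRingEnd ℂ (m x)) ψ ξ) := by
  rw [← SchwartzMap.integral_inner_fourier_fourier (mult m f) ψ,
    ← SchwartzMap.integral_inner_fourier_fourier f]
  congr 1 with x
  rw [fourier_mult_apply hm.hasTemperateGrowth, fourier_mult_apply hm.conj.hasTemperateGrowth]
  simp only [RCLike.inner_apply, map_mul]
  ring

lemma wnorm_conj (s : ℝ) (f : E d → ℂ) : wnorm s (starRingEnd ℂ ∘ f) = wnorm s f := by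
  refine eLpNorm_congr_norm_ae (Eventually.of_forall fun ξ => ?_)
  simp

lemma wnorm_sq_eq_enorm_integral (s : ℝ) (f : 𝓢(E d, ℂ)) :
    wnorm s f ^ 2 = ‖∫ ξ, inner ℂ (f ξ) (jap ξ ^ (2 * s) • f ξ)‖ₑ := by
  have hpos : ∀ ξ, 0 ≤ jap ξ ^ (2 * s) * ‖f ξ‖ ^ 2 := fun ξ =>
    mul_nonneg (jap_rpow_pos _ ξ).le (sq_nonneg _)
  have hfin : Integrable (fun ξ => jap ξ ^ (2 * s) * ‖f ξ‖ ^ 2) volume := by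
    refine ⟨((continuous_jap_rpow _).mul (f.continuous.norm.pow 2)).aestronglyMeasurable, ?_⟩
    rw [hasFiniteIntegral_iff_ofReal (Eventually.of_forall hpos), ← wnorm_sq]
    exact ENNReal.pow_lt_top (wnorm_lt_top s f)
  have h : ∀ ξ, inner ℂ (f ξ) (jap ξ ^ (2 * s) • f ξ)
      = ((jap ξ ^ (2 * s) * ‖f ξ‖ ^ 2 : ℝ) : ℂ) := fun ξ => by
    rw [RCLike.inner_apply, Complex.real_smul, mul_assoc, Complex.mul_conj, Complex.normSq_eq_norm_sq]
    push_cast; rfl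
  simp_rw [h]
  rw [integral_complex_ofReal, wnorm_sq, ← ofReal_integral_eq_lintegral_ofReal hfin
    (Eventually.of_forall hpos), ← ofReal_norm, Complex.norm_real,
    Real.norm_of_nonneg (integral_nonneg hpos)]

lemma mult_bound_neg {s : ℝ} (hs : 0 ≤ s) {m : E d → ℂ} (hm : IsSymbol 0 m) :
    ∃ C : ℝ≥0, ∀ f : 𝓢(E d, ℂ), wnorm (-s) (mult m f) ≤ C * wnorm (-s) f := by
  obtain ⟨C, hC⟩ := mult_bound_nonneg hs hm.conj
  refine ⟨C, fun f => ?_⟩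
  rcases eq_or_ne (wnorm (-s) (mult m f)) 0 with h0 | h0
  · rw [h0]; exact zero_le
  have hw := hasTemperateGrowth_jap_rpow (d := d) (2 * (-s))
  set ψ : 𝓢(E d, ℂ) := SchwartzMap.smulLeftCLM ℂ (fun ξ : E d => jap ξ ^ (2 * (-s))) (mult m f)
  have hψ : ∀ ξ, ψ ξ = jap ξ ^ (2 * (-s)) • mult m f ξ := fun ξ =>
    SchwartzMap.smulLeftCLM_apply_apply hw _ ξ
  have hψn : wnorm s ψ = wnorm (-s) (mult m f) := by
    unfold wnorm
    congr 1 with ξ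
    rw [hψ, smul_smul, ← jap_rpow_add]
    congr 2; ring
  have key : wnorm (-s) (mult m f) * wnorm (-s) (mult m f)
      ≤ (C * wnorm (-s) f) * wnorm (-s) (mult m f) := by
    rw [← sq, wnorm_sq_eq_enorm_integral]
    simp_rw [← hψ]
    rw [integral_inner_mult hm]
    simp_rw [RCLike.inner_apply, mul_comm _ (starRingEnd ℂ (f _))]
    refine (enorm_integral_mul_le s
      (Complex.continuous_conj.comp f.continuous).aestronglyMeasurable
      (SchwartzMap.continuous _).aestronglyMeasurable).trans ?_
    rw [wnorm_conj, ← hψn, mul_right_comm, mul_comm]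
    gcongr
    exact hC ψ
  exact (ENNReal.mul_le_mul_iff_left h0 (wnorm_lt_top _ _).ne).1 key

/-- A Sobolev-type seminorm of order `N` relative to the weight `⟨ξ⟩^(-s)`. -/
def derivNorm : ℕ → ℝ → 𝓢(E d, ℂ) → ℝ≥0∞
  | 0, s, φ => wnorm (-s) φ
  | N + 1, s, φ => derivNorm N s φ + ∑ j : Fin d, derivNorm N s (∂_{basisVec j} φ)

lemma derivNorm_mult_le {s : ℝ} (hs : 0 ≤ s) (N : ℕ) : ∀ {m : E d → ℂ}, IsSymbol (-(N : ℝ)) m →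
    ∃ C : ℝ≥0, ∀ f : 𝓢(E d, ℂ), derivNorm N s (mult m f) ≤ C * wnorm (-s) f := by
  induction N with
  | zero => intro m hm; exact mult_bound_neg hs (by simpa using hm)
  | succ N ih =>
    intro m hm
    push_cast at hm
    obtain ⟨C, hC⟩ := ih (hm.mono (by linarith))
    have hd : ∀ j, IsSymbol (-(N : ℝ))
        (fun x => (2 * Real.pi * Complex.I) * ((x j : ℂ) * m x)) := fun j => by
      have := (IsSymbol.const (d := d) (2 * Real.pi * Complex.I)).mul ((IsSymbol.coord j).mul hm)
      exact this.mono (by linarith)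
    choose D hD using fun j => ih (hd j)
    refine ⟨C + ∑ j, D j, fun f => ?_⟩
    push_cast
    rw [derivNorm, add_mul, Finset.sum_mul]
    gcongr with j
    · exact hC f
    · rw [lineDeriv_mult j hm.hasTemperateGrowth]
      exact hD j f

lemma IsSymbol.hasTemperateGrowth_mul {r : ℝ} {e b : E d → ℂ} (hb : IsSymbol r b)
    (he : e.HasTemperateGrowth) : (fun x => e x * b x).HasTemperateGrowth :=
  he.mul hb.hasTemperateGrowth

lemma integrable_mul_schwartz {g : E d → ℂ} (hg : MemLp g 2 volume) (φ : 𝓢(E d, ℂ)) :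
    Integrable (fun ξ => g ξ * φ ξ) volume :=
  hg.integrable_mul (φ.memLp 2 volume)

/-- The bilinear pairing of an `L²` function with Schwartz functions. -/
def pairing {g : E d → ℂ} (hg : MemLp g 2 volume) : 𝓢(E d, ℂ) →ₗ[ℂ] ℂ where
  toFun φ := ∫ ξ, g ξ * φ ξ
  map_add' φ ψ := by
    simp only [add_apply, mul_add]
    exact integral_add (integrable_mul_schwartz hg φ) (integrable_mul_schwartz hg ψ)
  map_smul' c φ := by
    simp only [smul_apply, smul_eq_mul, RingHom.id_apply, mul_left_comm]
    exact integral_const_mul _ _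

lemma pairing_apply {g : E d → ℂ} (hg : MemLp g 2 volume) (φ : 𝓢(E d, ℂ)) :
    pairing hg φ = ∫ ξ, g ξ * φ ξ := rfl

lemma pairing_lineDeriv {u g v h : E d → ℂ} {j : Fin d} (hu : IsFourierL2 u g)
    (hv : IsFourierL2 v h) (hvu : ∀ x, v x = (2 * Real.pi * Complex.I) * ((x j : ℂ) * u x))
    (ψ : 𝓢(E d, ℂ)) : pairing hu.2.1 (∂_{basisVec j} ψ) = pairing hv.2.1 ψ := by
  rw [pairing_apply, pairing_apply, ← hu.2.2, ← hv.2.2, ← SchwartzMap.fourier_coe,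
    ← SchwartzMap.fourier_coe]
  congr 1 with x
  rw [fourier_lineDeriv, hvu]
  ring

lemma memLp_jap_pow_of_le {u : E d → ℂ} {M N : ℕ} (hMN : M ≤ N)
    (hu : AEStronglyMeasurable u volume) (h : MemLp (fun x => jap x ^ N • u x) 2 volume) :
    MemLp (fun x => jap x ^ M • u x) 2 volume ∧
      eLpNorm (fun x => jap x ^ M • u x) 2 volume ≤ eLpNorm (fun x => jap x ^ N • u x) 2 volume := by
  have hle : ∀ x, ‖jap x ^ M • u x‖ ≤ ‖jap x ^ N • u x‖ := fun x => by
    have := jap_pos x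
    simp only [norm_smul, norm_pow, Real.norm_of_nonneg this.le]
    gcongr
    exact one_le_jap x
  exact ⟨h.mono ((continuous_jap.pow M).aestronglyMeasurable.smul hu) (Eventually.of_forall hle),
    eLpNorm_mono hle⟩

lemma memLp_jap_pow_coord {u : E d → ℂ} {N : ℕ} (j : Fin d)
    (hu : AEStronglyMeasurable u volume) (h : MemLp (fun x => jap x ^ (N + 1) • u x) 2 volume) :
    MemLp (fun x => jap x ^ N • ((2 * Real.pi * Complex.I) * ((x j : ℂ) * u x))) 2 volume ∧
      eLpNorm (fun x => jap x ^ N • ((2 * Real.pi * Complex.I) * ((x j : ℂ) * u x))) 2 volume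
        ≤ ENNReal.ofReal (2 * Real.pi) * eLpNorm (fun x => jap x ^ (N + 1) • u x) 2 volume := by
  have hle : ∀ x : E d, ‖jap x ^ N • ((2 * Real.pi * Complex.I) * ((x j : ℂ) * u x))‖
      ≤ (2 * Real.pi) * ‖jap x ^ (N + 1) • u x‖ := fun x => by
    have hj := jap_pos x
    have hx := abs_coord_le_jap x j
    simp only [norm_smul, norm_pow, norm_mul, Real.norm_of_nonneg hj.le, Complex.norm_real,
      Complex.norm_I, Real.norm_eq_abs, abs_of_pos Real.pi_pos, RCLike.norm_ofNat, mul_one]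
    calc _ ≤ jap x ^ N * (2 * Real.pi * (jap x * ‖u x‖)) := by gcongr
      _ = _ := by ring
  refine ⟨h.of_le_mul ?_ (Eventually.of_forall hle),
    eLpNorm_le_mul_eLpNorm_of_ae_le_mul (Eventually.of_forall hle) 2⟩
  have hc : Continuous fun x : E d => (x j : ℂ) :=
    Complex.continuous_ofReal.comp (EuclideanSpace.proj j : E d →L[ℝ] ℝ).continuous
  exact (continuous_jap.pow N).aestronglyMeasurable.smul
    ((hc.aestronglyMeasurable.mul hu).const_mul _)

lemma lineDeriv_smulLeft {c : E d → ℂ} (hc : c.HasTemperateGrowth) (φ : 𝓢(E d, ℂ)) (v x : E d) :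
    (∂_{v} (SchwartzMap.smulLeftCLM ℂ c φ)) x = fderiv ℝ c x v * φ x + c x * (∂_{v} φ) x := by
  have h : ⇑(SchwartzMap.smulLeftCLM ℂ c φ) = fun x => c x * φ x := by
    ext x; rw [SchwartzMap.smulLeftCLM_apply_apply hc, smul_eq_mul]
  rw [SchwartzMap.lineDerivOp_apply_eq_fderiv, SchwartzMap.lineDerivOp_apply_eq_fderiv, h,
    fderiv_fun_mul (hc.1.differentiable (by simp) x) φ.differentiableAt]
  simp only [add_apply, smul_apply, smul_eq_mul]
  ring

/-- Integration by parts along the phase: each power of the weight `⟨x⟩` on `u` gains a factor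
`⟨ξ⟩^(-κ)`. -/
lemma pairing_bound {κ : ℝ} {e χ : E d → ℂ} {a : Fin d → E d → ℂ} (he : e.HasTemperateGrowth)
    (he1 : ∀ x, ‖e x‖ ≤ 1) (ha : ∀ j, IsSymbol (-κ) (a j)) (hχ : IsSymbol (-κ) χ)
    (hid : ∀ x, ∑ j, a j x * fderiv ℝ e x (basisVec j) = (1 - χ x) * e x) (N : ℕ) :
    ∀ {r s : ℝ} {b : E d → ℂ}, r + s = κ * N → IsSymbol r b → ∃ C : ℝ≥0,
      ∀ (u g : E d → ℂ) (_ : MemLp (fun x => jap x ^ N • u x) 2 volume) (hg : IsFourierL2 u g)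
        (φ : 𝓢(E d, ℂ)),
        ‖pairing hg.2.1 (SchwartzMap.smulLeftCLM ℂ (fun x => e x * b x) φ)‖ₑ
          ≤ C * eLpNorm (fun x => jap x ^ N • u x) 2 volume * derivNorm N s φ := by
  induction N with
  | zero =>
    intro r s b hrs hb
    obtain ⟨C, hC⟩ := hb.norm_le
    refine ⟨C, fun u g hu hg φ => ?_⟩
    have h1 := enorm_integral_mul_le 0 hg.2.1.1
      (SchwartzMap.smulLeftCLM ℂ (fun x => e x * b x) φ).continuous.aestronglyMeasurable
    rw [neg_zero, wnorm_zero, hg.eLpNorm_eq] at h1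
    have h2 : wnorm 0 (SchwartzMap.smulLeftCLM ℂ (fun x => e x * b x) φ) ≤ C * wnorm (-s) φ := by
      refine wnorm_congr_le fun ξ => ?_
      rw [SchwartzMap.smulLeftCLM_apply_apply (hb.hasTemperateGrowth_mul he),
        show -s = r by simp at hrs; linarith]
      simp only [smul_eq_mul, norm_mul, Real.rpow_zero, one_mul]
      calc ‖e ξ‖ * ‖b ξ‖ * ‖φ ξ‖ ≤ 1 * (C * jap ξ ^ r) * ‖φ ξ‖ := by
            gcongr
            · exact he1 ξ
            · exact hC ξ
        _ = _ := by ring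
    rw [pairing_apply]
    simp only [pow_zero, one_smul, derivNorm]
    calc _ ≤ _ := h1
      _ ≤ eLpNorm u 2 volume * (C * wnorm (-s) φ) := by gcongr
      _ = _ := by ring
  | succ N ih =>
    intro r s b hrs hb
    push_cast at hrs
    have hord : (-κ + r) + s = κ * N := by linarith
    obtain ⟨C₀, hC₀⟩ := ih hord (hχ.mul hb)
    have hab : ∀ j, IsSymbol (-κ + r) (fun x => a j x * b x) := fun j => (ha j).mul hb
    choose C₁ hC₁ using fun j => ih hord (hab j)
    choose C₂ hC₂ using fun j => ih hord ((hab j).fderiv_apply (basisVec j))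
    refine ⟨C₀ + ∑ j, ((2 * Real.pi).toNNReal * C₁ j + C₂ j + C₁ j), fun u g hu hg φ => ?_⟩
    obtain ⟨hu', hule⟩ := memLp_jap_pow_of_le N.le_succ hg.1.1 hu
    have hum := fun j => memLp_jap_pow_coord j hg.1.1 hu
    have hum0 : ∀ j, MemLp (fun x : E d => (2 * Real.pi * Complex.I) * ((x j : ℂ) * u x)) 2
        volume := fun j => by
      have := (memLp_jap_pow_coord (N := 0) j hg.1.1
        (memLp_jap_pow_of_le (by omega) hg.1.1 hu).1).1
      simpa using this
    have hgj := fun j => isFourierL2_toLp (hum0 j)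
    have htab := fun j => (hab j).hasTemperateGrowth_mul he
    have htab' := fun j => ((hab j).fderiv_apply (basisVec j)).hasTemperateGrowth_mul he
    have decomp : SchwartzMap.smulLeftCLM ℂ (fun x => e x * b x) φ =
        SchwartzMap.smulLeftCLM ℂ (fun x => e x * (χ x * b x)) φ
        + ∑ j, (∂_{basisVec j} (SchwartzMap.smulLeftCLM ℂ (fun x => e x * (a j x * b x)) φ)
          - SchwartzMap.smulLeftCLM ℂ
              (fun x => e x * fderiv ℝ (fun x => a j x * b x) x (basisVec j)) φ
          - SchwartzMap.smulLeftCLM ℂ (fun x => e x * (a j x * b x)) (∂_{basisVec j} φ)) := by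
      ext x
      have hterm : ∀ j, (∂_{basisVec j} (SchwartzMap.smulLeftCLM ℂ
            (fun x => e x * (a j x * b x)) φ)
          - SchwartzMap.smulLeftCLM ℂ
              (fun x => e x * fderiv ℝ (fun x => a j x * b x) x (basisVec j)) φ
          - SchwartzMap.smulLeftCLM ℂ (fun x => e x * (a j x * b x)) (∂_{basisVec j} φ)) x
          = (a j x * fderiv ℝ e x (basisVec j)) * (b x * φ x) := fun j => by
        rw [sub_apply, sub_apply, lineDeriv_smulLeft (htab j),
          SchwartzMap.smulLeftCLM_apply_apply (htab' j),
          SchwartzMap.smulLeftCLM_apply_apply (htab j),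
          fderiv_fun_mul (he.1.differentiable (by simp) x)
            ((hab j).contDiff.differentiable (by simp) x)]
        simp only [add_apply, smul_apply, smul_eq_mul]
        ring
      rw [add_apply, sum_apply]
      simp_rw [hterm]
      rw [← Finset.sum_mul, hid, SchwartzMap.smulLeftCLM_apply_apply (hb.hasTemperateGrowth_mul he),
        SchwartzMap.smulLeftCLM_apply_apply ((hχ.mul hb).hasTemperateGrowth_mul he)]
      simp only [smul_eq_mul]
      ring
    set U := eLpNorm (fun x => jap x ^ (N + 1) • u x) 2 volume with hU
    have hS : derivNorm N s φ ≤ derivNorm (N + 1) s φ := le_self_add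
    have hSj : ∀ j, derivNorm N s (∂_{basisVec j} φ) ≤ derivNorm (N + 1) s φ := fun j =>
      (Finset.single_le_sum (f := fun j : Fin d => derivNorm N s (∂_{basisVec j} φ))
        (fun _ _ => zero_le) (Finset.mem_univ j)).trans le_add_self
    rw [decomp, map_add, map_sum]
    push_cast
    rw [add_mul, add_mul, Finset.sum_mul, Finset.sum_mul]
    refine (enorm_add_le _ _).trans (add_le_add ?_ ((enorm_sum_le _ _).trans
      (Finset.sum_le_sum fun j _ => ?_)))
    · exact (hC₀ u g hu' hg φ).trans (by gcongr)
    · rw [map_sub, map_sub, pairing_lineDeriv hg (hgj j) (fun x => rfl), add_mul, add_mul, add_mul,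
        add_mul]
      refine enorm_sub_le.trans (add_le_add (enorm_sub_le.trans (add_le_add ?_ ?_)) ?_)
      · refine (hC₁ j _ _ (hum j).1 (hgj j) φ).trans ?_
        calc _ ≤ C₁ j * (ENNReal.ofReal (2 * Real.pi) * U) * derivNorm (N + 1) s φ := by
              gcongr
              exact (hum j).2
          _ = _ := by rw [ENNReal.ofReal]; ring
      · exact (hC₂ j u g hu' hg φ).trans (by gcongr)
      · exact (hC₁ j u g hu' hg _).trans (by gcongr; exact hSj j)

lemma iteratedDeriv_cexp_const_mul_ofReal (c : ℂ) (n : ℕ) :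
    iteratedDeriv n (fun y : ℝ => Complex.exp (c * y)) =
      fun y : ℝ => c ^ n * Complex.exp (c * y) := by
  induction n with
  | zero => simp
  | succ n ih =>
    rw [iteratedDeriv_succ, ih]
    ext y
    have h : HasDerivAt (fun y : ℝ => Complex.exp (c * y)) (Complex.exp (c * y) * (c * 1)) y :=
      ((Complex.ofRealCLM.hasDerivAt).const_mul c).cexp
    rw [(h.const_mul (c ^ n)).deriv]
    ring

lemma hasTemperateGrowth_cexp_mul_I (σ : ℝ) :
    (fun y : ℝ => Complex.exp (Complex.I * σ * y)).HasTemperateGrowth := by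
  refine ⟨Complex.contDiff_exp.comp (contDiff_const.mul Complex.ofRealCLM.contDiff), fun n =>
    ⟨0, |σ| ^ n, fun y => ?_⟩⟩
  rw [norm_iteratedFDeriv_eq_norm_iteratedDeriv, iteratedDeriv_cexp_const_mul_ofReal]
  have : Complex.I * σ * y = ((σ * y : ℝ) : ℂ) * Complex.I := by push_cast; ring
  simp only [this, norm_mul, Complex.norm_exp_ofReal_mul_I]
  simp

section Phase

variable {β : ℝ} {V : E d → ℝ}

lemma homogeneous_of_sphere
    (hhom : ∀ ξ : E d, 1 ≤ ‖ξ‖ → V ξ = ‖ξ‖ ^ β * V (‖ξ‖⁻¹ • ξ)) {t : ℝ} {ξ : E d} (ht : 1 ≤ t)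
    (hξ : 1 ≤ ‖ξ‖) : V (t • ξ) = t ^ β * V ξ := by
  have ht0 : 0 < t := by linarith
  have hn : ‖t • ξ‖ = t * ‖ξ‖ := by rw [norm_smul, Real.norm_of_nonneg ht0.le]
  rw [hhom (t • ξ) (by rw [hn]; nlinarith), hhom ξ hξ, hn, Real.mul_rpow ht0.le (norm_nonneg _),
    smul_smul, mul_inv, mul_assoc]
  congr 4
  field_simp

lemma fderiv_homogeneous_of_one_lt (hV : ContDiff ℝ ∞ V)
    (hhom : ∀ ξ : E d, 1 ≤ ‖ξ‖ → V ξ = ‖ξ‖ ^ β * V (‖ξ‖⁻¹ • ξ)) {t : ℝ} {ξ : E d} (ht : 1 ≤ t)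
    (hξ : 1 < ‖ξ‖) : fderiv ℝ V (t • ξ) = t ^ (β - 1) • fderiv ℝ V ξ := by
  have ht0 : 0 < t := by linarith
  have hd : HasFDerivAt V (fderiv ℝ V ξ) ξ := (hV.differentiable (by simp) ξ).hasFDerivAt
  have hev : (fun y => V (t • y)) =ᶠ[𝓝 ξ] fun y => t ^ β • V y := by
    filter_upwards [continuous_norm.continuousAt.eventually (lt_mem_nhds hξ)] with y hy
    exact homogeneous_of_sphere hhom ht (le_of_lt hy)
  have h : t • fderiv ℝ V (t • ξ) = t ^ β • fderiv ℝ V ξ := by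
    rw [← (hd.fun_const_smul (t ^ β)).fderiv, ← hev.fderiv_eq]
    exact (fderiv_comp_smul t).symm
  calc fderiv ℝ V (t • ξ) = t⁻¹ • (t • fderiv ℝ V (t • ξ)) := by
        rw [smul_smul, inv_mul_cancel₀ ht0.ne', one_smul]
    _ = _ := by rw [h, smul_smul, Real.rpow_sub_one ht0.ne', div_eq_inv_mul]

lemma fderiv_homogeneous (hV : ContDiff ℝ ∞ V)
    (hhom : ∀ ξ : E d, 1 ≤ ‖ξ‖ → V ξ = ‖ξ‖ ^ β * V (‖ξ‖⁻¹ • ξ)) {t : ℝ} {ξ : E d} (ht : 1 ≤ t)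
    (hξ : 1 ≤ ‖ξ‖) : fderiv ℝ V (t • ξ) = t ^ (β - 1) • fderiv ℝ V ξ := by
  have hc : Continuous (fderiv ℝ V) := hV.continuous_fderiv (by simp)
  have hL : Continuous fun l : ℝ => fderiv ℝ V (t • (l • ξ)) := hc.comp (by fun_prop)
  have hξc : Continuous fun l : ℝ => fderiv ℝ V (l • ξ) := hc.comp (by fun_prop)
  have hR : Continuous fun l : ℝ => t ^ (β - 1) • fderiv ℝ V (l • ξ) := hξc.fun_const_smul _
  have heq : (fun l : ℝ => fderiv ℝ V (t • (l • ξ))) =ᶠ[𝓝[>] 1]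
      fun l => t ^ (β - 1) • fderiv ℝ V (l • ξ) := by
    filter_upwards [self_mem_nhdsWithin] with l hl
    have hl' : 1 < l := hl
    apply fderiv_homogeneous_of_one_lt hV hhom ht
    rw [norm_smul, Real.norm_of_nonneg (by linarith)]
    nlinarith
  have := tendsto_nhds_unique (((hL.tendsto 1).mono_left nhdsWithin_le_nhds).congr' heq)
    ((hR.tendsto 1).mono_left nhdsWithin_le_nhds)
  simpa only [one_smul] using this

/-- The square of the Euclidean length of the gradient, in coordinates. -/
def gradSq (V : E d → ℝ) (x : E d) : ℝ := ∑ k : Fin d, fderiv ℝ V x (basisVec k) ^ 2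

lemma gradSq_pos (hV : ContDiff ℝ ∞ V)
    (hhom : ∀ ξ : E d, 1 ≤ ‖ξ‖ → V ξ = ‖ξ‖ ^ β * V (‖ξ‖⁻¹ • ξ))
    (hgrad : ∀ η : E d, ‖η‖ = 1 → gradient V η ≠ 0) {ξ : E d} (hξ : 1 ≤ ‖ξ‖) :
    0 < gradSq V ξ := by
  have h0 : 0 < ‖ξ‖ := by linarith
  have hne : fderiv ℝ V ξ ≠ 0 := by
    have hη : ‖‖ξ‖⁻¹ • ξ‖ = 1 := by
      rw [norm_smul, norm_inv, norm_norm, inv_mul_cancel₀ h0.ne']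
    have h := fderiv_homogeneous hV hhom hξ hη.ge
    rw [smul_smul, mul_inv_cancel₀ h0.ne', one_smul] at h
    rw [h]
    refine smul_ne_zero (Real.rpow_pos_of_pos h0 _).ne' fun h' => hgrad _ hη ?_
    rw [gradient, h', map_zero]
  refine (Finset.sum_nonneg fun _ _ => sq_nonneg _).lt_of_ne' fun h => hne ?_
  rw [Finset.sum_eq_zero_iff_of_nonneg fun _ _ => sq_nonneg _] at h
  refine ContinuousLinearMap.coe_injective
    ((EuclideanSpace.basisFun (Fin d) ℝ).toBasis.ext fun k => ?_)
  have := h k (Finset.mem_univ k)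
  simpa using this

lemma contDiff_gradSq (hV : ContDiff ℝ ∞ V) : ContDiff ℝ ∞ (gradSq V) :=
  ContDiff.sum fun _ _ => ((hV.fderiv_right (mod_cast le_top)).clm_apply contDiff_const).pow 2

lemma isSymbol_of_vanishing {χ : E d → ℝ} (hχ : ContDiff ℝ ∞ χ) (h0 : ∀ x, 2 ≤ ‖x‖ → χ x = 0)
    (r : ℝ) : IsSymbol r χ :=
  IsSymbol.of_homogeneous hχ fun t x ht hx => by
    rw [h0 x hx.le, h0 (t • x), smul_zero]
    rw [norm_smul, Real.norm_of_nonneg (by linarith)]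
    nlinarith

lemma isSymbol_gradient_quotient (hV : ContDiff ℝ ∞ V)
    (hhom : ∀ ξ : E d, 1 ≤ ‖ξ‖ → V ξ = ‖ξ‖ ^ β * V (‖ξ‖⁻¹ • ξ))
    (hgrad : ∀ η : E d, ‖η‖ = 1 → gradient V η ≠ 0) {χ : E d → ℝ} (hχ : ContDiff ℝ ∞ χ)
    (h1 : ∀ x, ‖x‖ ≤ 3 / 2 → χ x = 1) (h0 : ∀ x, 2 ≤ ‖x‖ → χ x = 0) (j : Fin d) :
    IsSymbol (-(β - 1)) (fun x => (1 - χ x) * fderiv ℝ V x (basisVec j) / gradSq V x) := by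
  have hdj : ContDiff ℝ ∞ fun x => fderiv ℝ V x (basisVec j) :=
    (hV.fderiv_right (mod_cast le_top)).clm_apply contDiff_const
  refine IsSymbol.of_homogeneous (contDiff_iff_contDiffAt.2 fun x => ?_) fun t x ht hx => ?_
  · rcases lt_or_ge ‖x‖ (3 / 2) with hx | hx
    · refine (contDiffAt_const (c := (0 : ℝ))).congr_of_eventuallyEq ?_
      filter_upwards [continuous_norm.continuousAt.eventually (gt_mem_nhds hx)] with y hy
      rw [h1 y (le_of_lt hy)]; simp
    · exact ((contDiff_const.sub hχ).mul hdj).contDiffAt.div (contDiff_gradSq hV).contDiffAt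
        (gradSq_pos hV hhom hgrad (by linarith)).ne'
  · have ht0 : 0 < t := by linarith
    have hx1 : 1 ≤ ‖x‖ := by linarith
    have htx : 2 ≤ ‖t • x‖ := by
      rw [norm_smul, Real.norm_of_nonneg ht0.le]; nlinarith
    have hgs : gradSq V (t • x) = (t ^ (β - 1)) ^ 2 * gradSq V x := by
      simp only [gradSq, fderiv_homogeneous hV hhom ht hx1, smul_apply, smul_eq_mul, mul_pow,
        Finset.mul_sum]
    have hq := (gradSq_pos hV hhom hgrad hx1).ne'
    have htp := (Real.rpow_pos_of_pos ht0 (β - 1)).ne'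
    rw [h0 _ htx, h0 x hx.le, hgs, fderiv_homogeneous hV hhom ht hx1, Real.rpow_neg ht0.le]
    simp only [smul_apply, smul_eq_mul, sub_zero, one_mul]
    field_simp

lemma hasTemperateGrowth_phase (hV : ContDiff ℝ ∞ V)
    (hhom : ∀ ξ : E d, 1 ≤ ‖ξ‖ → V ξ = ‖ξ‖ ^ β * V (‖ξ‖⁻¹ • ξ)) (σ : ℝ) :
    (fun ξ => Complex.exp (Complex.I * σ * V ξ)).HasTemperateGrowth := by
  have h : IsSymbol β V := IsSymbol.of_homogeneous hV fun t x ht hx =>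
    homogeneous_of_sphere hhom ht (by linarith)
  exact (hasTemperateGrowth_cexp_mul_I σ).comp h.hasTemperateGrowth

lemma fderiv_phase (hV : ContDiff ℝ ∞ V) (σ : ℝ) (x v : E d) :
    fderiv ℝ (fun ξ => Complex.exp (Complex.I * σ * V ξ)) x v =
      Complex.exp (Complex.I * σ * V x) * (Complex.I * σ * fderiv ℝ V x v) := by
  have h1 : HasFDerivAt V (fderiv ℝ V x) x := (hV.differentiable (by simp) x).hasFDerivAt
  have h2 : HasFDerivAt (fun ξ => (V ξ : ℂ)) (Complex.ofRealCLM.comp (fderiv ℝ V x)) x :=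
    Complex.ofRealCLM.hasFDerivAt.comp x h1
  rw [((h2.const_mul (Complex.I * σ)).cexp).fderiv]
  simp

/-- The dual estimate: pairing `F u` with `e^{iσV} φ`. -/
lemma phase_pairing_bound (hV : ContDiff ℝ ∞ V)
    (hhom : ∀ ξ : E d, 1 ≤ ‖ξ‖ → V ξ = ‖ξ‖ ^ β * V (‖ξ‖⁻¹ • ξ))
    (hgrad : ∀ η : E d, ‖η‖ = 1 → gradient V η ≠ 0) {σ : ℝ} (hσ : σ ≠ 0) (N : ℕ) :
    ∃ C : ℝ≥0, ∀ (u g : E d → ℂ), MemLp (fun x => jap x ^ N • u x) 2 volume → IsFourierL2 u g →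
      ∀ φ : 𝓢(E d, ℂ), ‖∫ ξ, Complex.exp (Complex.I * σ * V ξ) * g ξ * φ ξ‖ₑ
        ≤ C * eLpNorm (fun x => jap x ^ N • u x) 2 volume * derivNorm N ((β - 1) * N) φ := by
  obtain ⟨χ, hχ, -, -, hχ1, hχ0⟩ :=
    exists_cutoff (d := d) (by norm_num : (0 : ℝ) < 3 / 2) (by norm_num : (3 / 2 : ℝ) < 2)
  set e : E d → ℂ := fun ξ => Complex.exp (Complex.I * σ * V ξ) with he_def
  have he : e.HasTemperateGrowth := hasTemperateGrowth_phase hV hhom σ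
  have he1 : ∀ x, ‖e x‖ ≤ 1 := fun x => by
    have : Complex.I * σ * V x = ((σ * V x : ℝ) : ℂ) * Complex.I := by push_cast; ring
    rw [he_def]
    simp only [this, Complex.norm_exp_ofReal_mul_I, le_refl]
  have ha : ∀ j, IsSymbol (-(β - 1)) (fun x => (Complex.I * σ)⁻¹ *
      (((1 - χ x) * fderiv ℝ V x (basisVec j) / gradSq V x : ℝ) : ℂ)) := fun j => by
    have := (IsSymbol.const (d := d) (Complex.I * σ)⁻¹).mul
      (isSymbol_gradient_quotient hV hhom hgrad hχ hχ1 hχ0 j).ofReal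
    exact this.mono (by linarith)
  have hid : ∀ x, ∑ j, (Complex.I * σ)⁻¹ *
      (((1 - χ x) * fderiv ℝ V x (basisVec j) / gradSq V x : ℝ) : ℂ) *
        fderiv ℝ e x (basisVec j) = (1 - (χ x : ℂ)) * e x := fun x => by
    have hI : Complex.I * σ ≠ 0 := by simp [hσ]
    rcases le_or_gt ‖x‖ (3 / 2) with hx | hx
    · simp [hχ1 x hx]
    have hq : gradSq V x ≠ 0 := (gradSq_pos hV hhom hgrad (by linarith)).ne'
    have hq' : (gradSq V x : ℂ) ≠ 0 := mod_cast hq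
    have hterm : ∀ j, (Complex.I * σ)⁻¹ *
        (((1 - χ x) * fderiv ℝ V x (basisVec j) / gradSq V x : ℝ) : ℂ) *
          fderiv ℝ e x (basisVec j)
        = (1 - (χ x : ℂ)) * e x / gradSq V x * ((fderiv ℝ V x (basisVec j) ^ 2 : ℝ) : ℂ) :=
      fun j => by
        have hσ' : (σ : ℂ) ≠ 0 := mod_cast hσ
        rw [fderiv_phase hV]
        change _ * (e x * _) = _
        push_cast
        field_simp
    simp_rw [hterm]
    rw [← Finset.mul_sum, ← Complex.ofReal_sum]
    change _ / _ * (gradSq V x : ℂ) = _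
    field_simp
  obtain ⟨C, hC⟩ := pairing_bound he he1 ha (isSymbol_of_vanishing hχ hχ0 _).ofReal hid N
    (r := 0) (s := (β - 1) * N) (by ring) (IsSymbol.const 1)
  refine ⟨C, fun u g hu hg φ => ?_⟩
  refine le_trans (le_of_eq ?_) (hC u g hu hg φ)
  rw [pairing_apply]
  congr 2 with ξ
  rw [SchwartzMap.smulLeftCLM_apply_apply ((IsSymbol.const (1 : ℂ)).hasTemperateGrowth_mul he)]
  simp only [mul_one, smul_eq_mul]
  ring

end Phase

/-- An `L²` function whose pairings with Schwartz functions are bounded by `K` has norm at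
most `K`. -/
lemma eLpNorm_le_of_pairing_le {f : E d → ℂ} (hf : MemLp f 2 volume) {K : ℝ≥0∞} (hK : K ≠ ⊤)
    (h : ∀ φ : 𝓢(E d, ℂ), ‖∫ ξ, f ξ * φ ξ‖ₑ ≤ K * eLpNorm φ 2 volume) :
    eLpNorm f 2 volume ≤ K := by
  have hfc : MemLp (fun ξ => starRingEnd ℂ (f ξ)) 2 volume := hf.star
  set G := hfc.toLp _ with hG_def
  have hG : ∀ v : Lp ℂ 2 (volume : Measure (E d)), ‖inner ℂ G v‖ ≤ K.toReal * ‖v‖ := by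
    intro v
    refine (SchwartzMap.denseRange_toLpCLM (E := E d) (F := ℂ) (μ := volume) (p := 2)
      ENNReal.ofNat_ne_top).induction_on (p := fun v => ‖inner ℂ G v‖ ≤ K.toReal * ‖v‖) v
      (isClosed_le (by fun_prop) (by fun_prop)) fun φ => ?_
    have hin : inner ℂ G (φ.toLp 2 volume) = ∫ ξ, f ξ * φ ξ := by
      rw [L2.inner_def]
      refine integral_congr_ae ?_
      filter_upwards [hfc.coeFn_toLp, φ.coeFn_toLp 2 volume] with ξ h1 h2
      rw [h1, h2]
      simp [mul_comm]
    have h3 := ENNReal.toReal_mono (ENNReal.mul_ne_top hK (φ.memLp 2 volume).2.ne) (h φ)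
    rw [toReal_enorm, ENNReal.toReal_mul] at h3
    change ‖inner ℂ G (φ.toLp 2 volume)‖ ≤ K.toReal * ‖φ.toLp 2 volume‖
    rwa [hin, SchwartzMap.norm_toLp]
  have hn : ‖G‖ ≤ K.toReal := by
    have h1 := hG G
    rw [inner_self_eq_norm_sq_to_K, norm_pow, RCLike.norm_ofReal, abs_norm, sq] at h1
    rcases (norm_nonneg G).eq_or_lt with h0 | h0
    · rw [← h0]; exact ENNReal.toReal_nonneg
    · exact le_of_mul_le_mul_right h1 h0
  have he : eLpNorm f 2 volume = ‖G‖ₑ := by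
    rw [Lp.enorm_toLp]
    exact eLpNorm_congr_norm_ae (Eventually.of_forall fun ξ => by simp)
  rw [he, ← ofReal_norm]
  exact ENNReal.ofReal_le_of_le_toReal hn

lemma wnorm_le_of_pairing_le {h : E d → ℂ} (hh : MemLp h 2 volume) (s : ℝ) {K : ℝ≥0∞}
    (hK : K ≠ ⊤) (hp : ∀ φ : 𝓢(E d, ℂ), ‖∫ ξ, h ξ * φ ξ‖ₑ ≤ K * wnorm (-s) φ) :
    wnorm s h ≤ K := by
  choose χ hχ hχc hχ01 hχ1 hχ0 using fun n : ℕ =>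
    exists_cutoff (d := d) (by positivity : (0 : ℝ) < n + 1) (lt_add_one ((n : ℝ) + 1))
  set c : ℕ → E d → ℝ := fun n ξ => χ n ξ * jap ξ ^ s with hc_def
  have hcc : ∀ n, Continuous (c n) := fun n => (hχ n).continuous.mul (continuous_jap_rpow s)
  have hct : ∀ n, (c n).HasTemperateGrowth := fun n =>
    (hasTemperateGrowth_of_hasCompactSupport (hχ n) (hχc n)).mul (hasTemperateGrowth_jap_rpow s)
  have hmem : ∀ n, MemLp (fun ξ => c n ξ • h ξ) 2 volume := fun n => by
    obtain ⟨B, hB⟩ := (hcc n).bounded_above_of_compact_support (hχc n).mul_right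
    refine hh.of_le_mul (c := B) ((hcc n).aestronglyMeasurable.smul hh.1)
      (Eventually.of_forall fun ξ => ?_)
    rw [norm_smul]
    gcongr
    exact hB ξ
  have hbound : ∀ n, eLpNorm (fun ξ => c n ξ • h ξ) 2 volume ≤ K := fun n => by
    refine eLpNorm_le_of_pairing_le (hmem n) hK fun φ => ?_
    have hη : ∀ ξ, SchwartzMap.smulLeftCLM ℂ (c n) φ ξ = c n ξ • φ ξ :=
      SchwartzMap.smulLeftCLM_apply_apply (hct n) φ
    calc ‖∫ ξ, c n ξ • h ξ * φ ξ‖ₑ = ‖∫ ξ, h ξ * SchwartzMap.smulLeftCLM ℂ (c n) φ ξ‖ₑ := by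
          congr 2 with ξ
          rw [hη, smul_mul_assoc, mul_smul_comm]
      _ ≤ K * wnorm (-s) (SchwartzMap.smulLeftCLM ℂ (c n) φ) := hp _
      _ ≤ K * eLpNorm φ 2 volume := by
          gcongr
          refine eLpNorm_mono fun ξ => ?_
          rw [hη, smul_smul, hc_def]
          have h1 : jap ξ ^ (-s) * (χ n ξ * jap ξ ^ s) = χ n ξ := by
            rw [mul_left_comm, ← jap_rpow_add]; simp
          simp only [h1, norm_smul, Real.norm_of_nonneg (hχ01 n ξ).1]
          exact mul_le_of_le_one_left (norm_nonneg _) (hχ01 n ξ).2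
  refine (Lp.eLpNorm_lim_le_liminf_eLpNorm (fun n => (hmem n).1) _
    (Eventually.of_forall fun ξ => ?_)).trans
    (liminf_le_of_le (by isBoundedDefault) fun b hb => ?_)
  · refine tendsto_const_nhds.congr' ?_
    filter_upwards [eventually_ge_atTop ⌈‖ξ‖⌉₊] with n hn
    have : ‖ξ‖ ≤ n := (Nat.le_ceil _).trans (mod_cast hn)
    rw [hc_def]
    simp only [hχ1 n ξ (by linarith), one_mul]
  · obtain ⟨n, hn⟩ := hb.exists
    exact hn.trans (hbound n)

lemma fourier_pairing_weight {w k h : E d → ℂ} {N : ℕ} (hw : IsFourierL2 w k)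
    (hh : IsFourierL2 (fun x => (jap x ^ N)⁻¹ • w x) h) (φ : 𝓢(E d, ℂ)) :
    ∫ ξ, h ξ * φ ξ = ∫ ξ, k ξ * mult (fun x => ((jap x ^ (-(N : ℝ)) : ℝ) : ℂ)) φ ξ := by
  rw [← hh.2.2, ← hw.2.2, ← SchwartzMap.fourier_coe, ← SchwartzMap.fourier_coe]
  congr 1 with x
  rw [fourier_mult_apply (IsSymbol.jap_rpow (-(N : ℝ))).ofReal.hasTemperateGrowth,
    Real.rpow_neg (jap_pos x).le, Real.rpow_natCast]
  simp only [Complex.real_smul]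
  ring

end

/-- Lemma 11: weighted smoothing estimate for the Fourier multiplier `e^{iσV(D)}`. -/
theorem stmt19 (d : ℕ) (hd : 1 ≤ d) (β : ℝ) (hβ : 1 < β)
    (V : E d → ℝ) (hV : ContDiff ℝ (⊤ : ℕ∞) V)
    (hhom : ∀ ξ : E d, 1 ≤ ‖ξ‖ → V ξ = ‖ξ‖ ^ β * V (‖ξ‖⁻¹ • ξ))
    (hgrad : ∀ ω : E d, ‖ω‖ = 1 → gradient V ω ≠ 0)
    (σ : ℝ) (hσ : σ ≠ 0) (N : ℕ) :
    ∃ C > 0, ∀ u g w h : E d → ℂ,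
      MemLp (fun x => (jap x) ^ N • u x) 2 (volume : Measure (E d)) →
      IsFourierL2 u g →
      IsFourierL2 w (fun ξ => Complex.exp (Complex.I * σ * V ξ) * g ξ) →
      IsFourierL2 (fun x => ((jap x) ^ N)⁻¹ • w x) h →
      MemLp (fun ξ => jap ξ ^ ((β - 1) * (N : ℝ)) • h ξ) 2 (volume : Measure (E d)) ∧
      eLpNorm (fun ξ => jap ξ ^ ((β - 1) * (N : ℝ)) • h ξ) 2 volume
        ≤ ENNReal.ofReal C * eLpNorm (fun x => (jap x) ^ N • u x) 2 volume := by
  have hs : 0 ≤ (β - 1) * (N : ℝ) := mul_nonneg (by linarith) N.cast_nonneg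
  obtain ⟨C₁, hC₁⟩ := phase_pairing_bound hV hhom hgrad hσ N
  obtain ⟨C₂, hC₂⟩ := derivNorm_mult_le hs N (IsSymbol.jap_rpow (d := d) (-(N : ℝ))).ofReal
  refine ⟨C₁ * C₂ + 1, by positivity, fun u g w h hu hg hw hh => ?_⟩
  set U := eLpNorm (fun x => jap x ^ N • u x) 2 volume
  have hbound : wnorm ((β - 1) * N) h ≤ C₁ * U * C₂ := by
    refine wnorm_le_of_pairing_le hh.2.1 _
      (ENNReal.mul_ne_top (ENNReal.mul_ne_top ENNReal.coe_ne_top hu.2.ne) ENNReal.coe_ne_top)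
      fun φ => ?_
    rw [fourier_pairing_weight hw hh]
    calc _ ≤ C₁ * U * derivNorm N ((β - 1) * N) _ := hC₁ u g hu hg _
      _ ≤ C₁ * U * (C₂ * wnorm (-((β - 1) * N)) φ) := by gcongr; exact hC₂ φ
      _ = _ := by ring
  have hle : wnorm ((β - 1) * N) h ≤ ENNReal.ofReal (C₁ * C₂ + 1) * U := by
    refine hbound.trans ?_
    rw [mul_right_comm]
    gcongr
    rw [← ENNReal.coe_mul, ← ENNReal.ofReal_coe_nnreal]
    refine ENNReal.ofReal_le_ofReal ?_
    push_cast
    linarith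
  exact ⟨⟨aestronglyMeasurable_jap_smul _ hh.2.1.1,
    hle.trans_lt (ENNReal.mul_lt_top ENNReal.ofReal_lt_top hu.2)⟩, hle⟩
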